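/- arXiv:0903.2779 — 3 statements merged into one kernel-verified Lean document; each statement's English description precedes it below -/
import Mathlib

section
/- An R-module is Gorenstein projective if and only if it is a direct summand of a strongly Gorenstein projective R-module. -/
open CategoryTheory

noncomputable section

namespace GW

variable (R : Type) [CommRing R]

/-- `M` is a Gorenstein projective module: there is a doubly infinite exact sequence of
projective modules, remaining exact under `Hom(-, Q)` for every projective `Q`, with `M`
isomorphic to one of its kernels (equivalently, images). -/
def IsGProj (M : ModuleCat.{0} R) : Prop :=
  ∃ (P : ℤ → ModuleCat.{0} R) (d : ∀ i, P i →ₗ[R] P (i + 1)),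
    (∀ i, Module.Projective R (P i)) ∧
    (∀ i, Function.Exact (d i) (d (i + 1))) ∧
    (∀ (Q : ModuleCat.{0} R), Module.Projective R Q →
      ∀ i, Function.Exact
        (fun g : P (i + 1 + 1) →ₗ[R] Q => g.comp (d (i + 1)))
        (fun g : P (i + 1) →ₗ[R] Q => g.comp (d i))) ∧
    Nonempty (M ≃ₗ[R] LinearMap.ker (d 0))

/-- `M` is a strongly Gorenstein projective module. -/
def IsSGProj (M : ModuleCat.{0} R) : Prop :=
  ∃ (P : ModuleCat.{0} R) (f : P →ₗ[R] P),
    Module.Projective R P ∧ Function.Exact f f ∧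
    (∀ (Q : ModuleCat.{0} R), Module.Projective R Q →
      Function.Exact (fun g : P →ₗ[R] Q => g.comp f) (fun g : P →ₗ[R] Q => g.comp f)) ∧
    Nonempty (M ≃ₗ[R] LinearMap.range f)

/-- Gorenstein projective dimension at most `n`, via resolutions by Gorenstein projectives. -/
def gpdLE : ℕ → ModuleCat.{0} R → Prop
  | 0, M => IsGProj R M
  | (n + 1), M => ∃ (K G : ModuleCat.{0} R) (f : K →ₗ[R] G) (g : G →ₗ[R] M),
      IsGProj R G ∧ Function.Injective f ∧ Function.Surjective g ∧
      Function.Exact f g ∧ gpdLE n K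

/-- Gorenstein projective dimension, valued in `ℕ∞`. -/
def gpd (M : ModuleCat.{0} R) : ℕ∞ := ⨅ (n : ℕ) (_ : gpdLE R n M), (n : ℕ∞)

/-- `M` is a Gorenstein flat module. -/
def IsGFlat (M : ModuleCat.{0} R) : Prop :=
  ∃ (F : ℤ → ModuleCat.{0} R) (d : ∀ i, F i →ₗ[R] F (i + 1)),
    (∀ i, Module.Flat R (F i)) ∧
    (∀ i, Function.Exact (d i) (d (i + 1))) ∧
    (∀ (I : ModuleCat.{0} R), Module.Injective R I →
      ∀ i, Function.Exact (LinearMap.lTensor I (d i)) (LinearMap.lTensor I (d (i + 1)))) ∧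
    Nonempty (M ≃ₗ[R] LinearMap.ker (d 0))

/-- Gorenstein flat dimension at most `n`. -/
def gfdLE : ℕ → ModuleCat.{0} R → Prop
  | 0, M => IsGFlat R M
  | (n + 1), M => ∃ (K G : ModuleCat.{0} R) (f : K →ₗ[R] G) (g : G →ₗ[R] M),
      IsGFlat R G ∧ Function.Injective f ∧ Function.Surjective g ∧
      Function.Exact f g ∧ gfdLE n K

/-- Gorenstein flat dimension, valued in `ℕ∞`. -/
def gfd (M : ModuleCat.{0} R) : ℕ∞ := ⨅ (n : ℕ) (_ : gfdLE R n M), (n : ℕ∞)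

/-- The Gorenstein weak dimension of `R`: the supremum of Gorenstein flat dimensions. -/
def gwdim : ℕ∞ := ⨆ M : ModuleCat.{0} R, gfd R M

/-- Projective dimension at most `n`. -/
def pdLE : ℕ → ModuleCat.{0} R → Prop
  | 0, M => Module.Projective R M
  | (n + 1), M => ∃ (K G : ModuleCat.{0} R) (f : K →ₗ[R] G) (g : G →ₗ[R] M),
      Module.Projective R G ∧ Function.Injective f ∧ Function.Surjective g ∧
      Function.Exact f g ∧ pdLE n K

/-- Projective dimension, valued in `ℕ∞`. -/
def pd (M : ModuleCat.{0} R) : ℕ∞ := ⨅ (n : ℕ) (_ : pdLE R n M), (n : ℕ∞)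

/-- Flat dimension at most `n`. -/
def fdLE : ℕ → ModuleCat.{0} R → Prop
  | 0, M => Module.Flat R M
  | (n + 1), M => ∃ (K G : ModuleCat.{0} R) (f : K →ₗ[R] G) (g : G →ₗ[R] M),
      Module.Flat R G ∧ Function.Injective f ∧ Function.Surjective g ∧
      Function.Exact f g ∧ fdLE n K

/-- Flat dimension, valued in `ℕ∞`. -/
def fd (M : ModuleCat.{0} R) : ℕ∞ := ⨅ (n : ℕ) (_ : fdLE R n M), (n : ℕ∞)

/-- A coherent ring: every finitely generated ideal is finitely presented. -/
def IsCoherentRing : Prop := ∀ I : Ideal R, I.FG → Module.FinitePresentation R I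

/-- `Ext^n_R(M, N)` as a module. -/
def extGrp (n : ℕ) (M N : ModuleCat.{0} R) : ModuleCat R :=
  ((Ext R (ModuleCat.{0} R) n).obj (Opposite.op M)).obj N

/-- `Tor_n^R(M, N)`. -/
def torGrp (n : ℕ) (M N : ModuleCat.{0} R) : ModuleCat.{0} R :=
  ((Tor (ModuleCat.{0} R) n).obj M).obj N

/-- The Gorenstein global dimension of `R` (the common value of the suprema of Gorenstein
projective and Gorenstein injective dimensions), here the supremum of `Gpd`. -/
def ggldim : ℕ∞ := ⨆ M : ModuleCat.{0} R, gpd R M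

/-- `M` admits a finite resolution of length `n` by finitely generated projective modules. -/
def finFGRes : ℕ → ModuleCat.{0} R → Prop
  | 0, M => Module.Projective R M ∧ Module.Finite R M
  | (n + 1), M => ∃ (K G : ModuleCat.{0} R) (f : K →ₗ[R] G) (g : G →ₗ[R] M),
      Module.Projective R G ∧ Module.Finite R G ∧ Function.Injective f ∧
      Function.Surjective g ∧ Function.Exact f g ∧ finFGRes n K

/-- The small finitistic projective dimension of `R`. -/
def fPD : ℕ∞ :=
  ⨆ (M : ModuleCat.{0} R) (_ : (∃ n, finFGRes R n M) ∧ pd R M ≠ ⊤), pd R M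

/-- The small finitistic Gorenstein projective dimension of `R`. -/
def fGPD : ℕ∞ :=
  ⨆ (M : ModuleCat.{0} R) (_ : (∃ n, finFGRes R n M) ∧ gpd R M ≠ ⊤), gpd R M

/-- An arithmetical ring: every finitely generated ideal is locally principal. -/
def IsArithmetical : Prop :=
  ∀ I : Ideal R, I.FG → ∀ (p : Ideal R) (hp : p.IsMaximal),
    haveI := hp.isPrime
    (I.map (algebraMap R (Localization.AtPrime p))).IsPrincipal

/-- A quasi-Frobenius ring: Noetherian and self-injective. -/
def IsQuasiFrobenius : Prop := IsNoetherianRing R ∧ Module.Injective R R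

/-- The submodule `X • N` of a module `N` over a power series ring. -/
def Xsub {R : Type} [CommRing R] (N : ModuleCat.{0} (PowerSeries R)) :
    Submodule (PowerSeries R) N :=
  LinearMap.range (LinearMap.lsmul (PowerSeries R) N PowerSeries.X)

lemma Xsub_le {R : Type} [CommRing R] {N N' : ModuleCat.{0} (PowerSeries R)}
    (f : N →ₗ[PowerSeries R] N') : Xsub N ≤ (Xsub N').comap f := by
  rintro x ⟨k, rfl⟩
  exact ⟨f k, (map_smul f _ _).symm⟩

/-- The induced map `N/XN → N'/XN'`. -/
def qmap {R : Type} [CommRing R] {N N' : ModuleCat.{0} (PowerSeries R)}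
    (f : N →ₗ[PowerSeries R] N') :
    (N ⧸ Xsub N) →ₗ[PowerSeries R] (N' ⧸ Xsub N') :=
  Submodule.mapQ _ _ f (Xsub_le f)

end GW

namespace GWaux

variable {R : Type} [CommRing R]

/-- Short exact sequences. -/
def SES {A B C : Type} [AddCommGroup A] [AddCommGroup B] [AddCommGroup C]
    [Module R A] [Module R B] [Module R C] (i : A →ₗ[R] B) (p : B →ₗ[R] C) : Prop :=
  (∀ a, i a = 0 → a = 0) ∧ (∀ c, ∃ b, p b = c) ∧ (∀ a, p (i a) = 0) ∧
    (∀ b, p b = 0 → ∃ a, i a = b)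

lemma factor_surj {X Y Z : Type} [AddCommGroup X] [AddCommGroup Y] [AddCommGroup Z]
    [Module R X] [Module R Y] [Module R Z] (g : X →ₗ[R] Y) (hg : ∀ y, ∃ x, g x = y)
    (φ : X →ₗ[R] Z) (h : ∀ x, g x = 0 → φ x = 0) : ∃ ψ : Y →ₗ[R] Z, ∀ x, ψ (g x) = φ x := by
  choose s hs using hg
  have key : ∀ x x', g x = g x' → φ x = φ x' := by
    intro x x' e
    have := h (x - x') (by rw [map_sub, e, sub_self])
    rwa [map_sub, sub_eq_zero] at this
  refine ⟨{ toFun := fun y => φ (s y), map_add' := ?_, map_smul' := ?_ }, ?_⟩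
  · intro a b
    rw [← map_add]
    apply key
    simp [hs]
  · intro r a
    rw [RingHom.id_apply, ← map_smul]
    apply key
    simp [hs]
  · intro x
    exact key _ _ (hs _)

lemma factor_inj {X Y Z : Type} [AddCommGroup X] [AddCommGroup Y] [AddCommGroup Z]
    [Module R X] [Module R Y] [Module R Z] (f : X →ₗ[R] Y) (hf : ∀ x, f x = 0 → x = 0)
    (φ : Z →ₗ[R] Y) (h : ∀ z, ∃ x, f x = φ z) : ∃ ψ : Z →ₗ[R] X, ∀ z, f (ψ z) = φ z := by
  choose s hs using h
  have key : ∀ x x', f x = f x' → x = x' := by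
    intro x x' e
    have := hf (x - x') (by rw [map_sub, e, sub_self])
    rwa [sub_eq_zero] at this
  refine ⟨{ toFun := s, map_add' := ?_, map_smul' := ?_ }, hs⟩
  · intro a b
    apply key
    simp [hs]
  · intro r a
    apply key
    simp [hs]

lemma lift_proj {P X Y : Type} [AddCommGroup X] [AddCommGroup Y] [AddCommGroup P]
    [Module R X] [Module R Y] [Module R P] (hP : Module.Projective R P)
    (g : X →ₗ[R] Y) (hg : ∀ y, ∃ x, g x = y) (φ : P →ₗ[R] Y) :
    ∃ ψ : P →ₗ[R] X, ∀ z, g (ψ z) = φ z := by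
  obtain ⟨ψ, h⟩ := Module.projective_lifting_property g φ hg
  exact ⟨ψ, fun z => LinearMap.congr_fun h z⟩

/-- `Ext^1(B, Q) = 0` for all projective `Q`. -/
def V (B : ModuleCat.{0} R) : Prop :=
  ∀ (A C : ModuleCat.{0} R) (i : A →ₗ[R] C) (p : C →ₗ[R] B), SES i p →
    ∀ (Q : ModuleCat.{0} R), Module.Projective R Q → ∀ φ : A →ₗ[R] Q,
      ∃ ψ : C →ₗ[R] Q, ∀ a, ψ (i a) = φ a

def Step (C C' : ModuleCat.{0} R) : Prop :=
  ∃ (P : ModuleCat.{0} R) (f : C →ₗ[R] P) (g : P →ₗ[R] C'), Module.Projective R P ∧ SES f g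

lemma V_of_hext {K P B : ModuleCat.{0} R} (f : K →ₗ[R] P) (g : P →ₗ[R] B) (h : SES f g)
    (hP : Module.Projective R P)
    (hx : ∀ (Q : ModuleCat.{0} R), Module.Projective R Q → ∀ φ : K →ₗ[R] Q,
      ∃ ψ : P →ₗ[R] Q, ∀ a, ψ (f a) = φ a) : V B := by
  intro A C i p hS Q hQ φ
  obtain ⟨hi, hp, hpi, hex⟩ := hS
  obtain ⟨hf, hg, hgf, hex'⟩ := h
  obtain ⟨s, hs⟩ := lift_proj hP p hp g
  obtain ⟨α, hα⟩ := factor_inj i hi (s ∘ₗ f) (by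
    intro z
    apply hex
    simp [hs, hgf])
  obtain ⟨θ, hθ⟩ := hx Q hQ (φ ∘ₗ α)
  obtain ⟨ψ, hψ⟩ := factor_surj (i.coprod s) (by
    intro c
    obtain ⟨x, hx⟩ := hg (p c)
    obtain ⟨a, ha⟩ := hex (c - s x) (by rw [map_sub, hs, hx, sub_self])
    exact ⟨(a, x), by simp [ha]⟩) (φ.coprod θ) (by
    rintro ⟨a, x⟩ h0
    simp only [LinearMap.coprod_apply] at h0 ⊢
    have h1 : g x = 0 := by
      have := congrArg p h0
      simpa [hpi, hs] using this
    obtain ⟨b, rfl⟩ := hex' x h1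
    have h2 : a + α b = 0 := hi _ (by
      rw [map_add, hα]; exact h0)
    rw [hθ]
    have := congrArg φ h2
    simpa using this)
  refine ⟨ψ, fun a => ?_⟩
  have := hψ (a, 0)
  simpa using this

lemma V_ext {A C B : ModuleCat.{0} R} (i : A →ₗ[R] C) (p : C →ₗ[R] B) (h : SES i p)
    (hA : V A) (hB : V B) : V C := by
  intro K E j q hS Q hQ φ
  obtain ⟨hi, hp, hpi, hex⟩ := h
  obtain ⟨hj, hq, hqj, hex'⟩ := hS
  let W : Submodule R E := LinearMap.ker (p ∘ₗ q)
  obtain ⟨t, ht⟩ := factor_inj i hi (q ∘ₗ W.subtype) (by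
    intro z
    apply hex
    exact z.2)
  obtain ⟨ψ, hψ⟩ := hA K (ModuleCat.of R W) (j.codRestrict W (fun a => by
    simp [W, hqj])) t ⟨by
      intro a ha
      exact hj a (congrArg Subtype.val ha), by
      intro a
      obtain ⟨e, he⟩ := hq (i a)
      refine ⟨⟨e, by simp [W, he, hpi]⟩, ?_⟩
      apply sub_eq_zero.1
      apply hi
      rw [map_sub, ht]
      simp [he], by
      intro a
      apply hi
      rw [ht]
      simp [hqj], by
      intro b hb
      have := ht b
      rw [hb, map_zero] at this
      obtain ⟨a, ha⟩ := hex' b.1 this.symm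
      exact ⟨a, Subtype.ext ha⟩⟩ Q hQ φ
  obtain ⟨χ, hχ⟩ := hB (ModuleCat.of R W) E W.subtype (p ∘ₗ q) ⟨by
      intro a ha
      exact Subtype.ext ha, by
      intro b
      obtain ⟨c, rfl⟩ := hp b
      obtain ⟨e, rfl⟩ := hq c
      exact ⟨e, rfl⟩, fun a => a.2, fun b hb => ⟨⟨b, hb⟩, rfl⟩⟩ Q hQ ψ
  refine ⟨χ, fun a => ?_⟩
  rw [← hψ, ← hχ]
  rfl

lemma V_retract {M G : ModuleCat.{0} R} (ι : M →ₗ[R] G) (π : G →ₗ[R] M)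
    (h : ∀ m, π (ι m) = m) (hG : V G) : V M := by
  intro K E j q hS Q hQ φ
  obtain ⟨hj, hq, hqj, hex'⟩ := hS
  let W : Submodule R (E × G) := LinearMap.ker (q.coprod (-π))
  have memW : ∀ x : E × G, x ∈ W ↔ q x.1 = π x.2 := by
    intro x
    simp [W, ← sub_eq_add_neg, sub_eq_zero]
  obtain ⟨ψ, hψ⟩ := hG K (ModuleCat.of R W)
    ((LinearMap.inl R E G ∘ₗ j).codRestrict W (fun a => by simp [memW, hqj]))
    (LinearMap.snd R E G ∘ₗ W.subtype) ⟨by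
      intro a ha
      apply hj
      have := congrArg (fun x : W => x.1.1) ha
      exact this, by
      intro x
      obtain ⟨e, he⟩ := hq (π x)
      exact ⟨⟨(e, x), (memW _).2 he⟩, rfl⟩, fun a => rfl, by
      rintro ⟨⟨e, x⟩, hw⟩ hb
      have hb' : x = 0 := hb
      subst hb'
      obtain ⟨a, ha⟩ := hex' e (by simpa using (memW _).1 hw)
      exact ⟨a, Subtype.ext (Prod.ext ha rfl)⟩⟩ Q hQ φ
  refine ⟨ψ ∘ₗ ((LinearMap.id.prod (ι ∘ₗ q)).codRestrict W (fun e => by simp [memW, h])), ?_⟩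
  intro a
  rw [← hψ]
  show ψ _ = ψ _
  congr 1
  apply Subtype.ext
  show (j a, ι (q (j a))) = (j a, (0 : G))
  simp [hqj]

lemma horseshoe_right {A C B A' B' : ModuleCat.{0} R} (i : A →ₗ[R] C) (p : C →ₗ[R] B)
    (h : SES i p) (hB : V B) (hAA : Step A A') (hBB : Step B B') :
    ∃ (C' : ModuleCat.{0} R) (i' : A' →ₗ[R] C') (p' : C' →ₗ[R] B'), SES i' p' ∧ Step C C' := by
  obtain ⟨PA, fA, gA, hPA, hfA, hgA, hgfA, hexA⟩ := hAA
  obtain ⟨PB, fB, gB, hPB, hfB, hgB, hgfB, hexB⟩ := hBB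
  obtain ⟨a, ha⟩ := hB A C i p h PA hPA fA
  obtain ⟨hi, hp, hpi, hex⟩ := h
  let j : C →ₗ[R] (PA × PB) := a.prod (fB ∘ₗ p)
  obtain ⟨ψ, hψ⟩ := factor_surj gA hgA ((LinearMap.range j).mkQ ∘ₗ LinearMap.inl R PA PB) (by
    intro x hx
    obtain ⟨y, rfl⟩ := hexA x hx
    simp only [LinearMap.comp_apply, Submodule.mkQ_apply, Submodule.Quotient.mk_eq_zero]
    exact ⟨i y, by simp [j, ha, hpi]⟩)
  let p' : ((PA × PB) ⧸ LinearMap.range j) →ₗ[R] B' :=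
    (LinearMap.range j).liftQ (gB ∘ₗ LinearMap.snd R PA PB) (by
      rintro _ ⟨c, rfl⟩
      simp [j, hgfB])
  have hp' : ∀ x, p' ((LinearMap.range j).mkQ x) = gB x.2 := fun x => rfl
  refine ⟨ModuleCat.of R ((PA × PB) ⧸ LinearMap.range j), ψ, p', ⟨?_, ?_, ?_, ?_⟩,
    ModuleCat.of R (PA × PB), j, (LinearMap.range j).mkQ, ?_, ?_, ?_, ?_, ?_⟩
  · intro y hy
    obtain ⟨x, rfl⟩ := hgA y
    rw [hψ] at hy
    simp only [LinearMap.comp_apply, Submodule.mkQ_apply, Submodule.Quotient.mk_eq_zero] at hy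
    obtain ⟨c, hc⟩ := hy
    have h1 : a c = x := congrArg Prod.fst hc
    have h2 : fB (p c) = 0 := congrArg Prod.snd hc
    obtain ⟨y, rfl⟩ := hex c (hfB _ h2)
    rw [← h1, ha, hgfA]
  · intro b
    obtain ⟨x, rfl⟩ := hgB b
    exact ⟨(LinearMap.range j).mkQ (0, x), rfl⟩
  · intro y
    obtain ⟨x, rfl⟩ := hgA y
    rw [hψ]
    show gB 0 = 0
    simp
  · intro b hb
    obtain ⟨⟨x, y⟩, rfl⟩ := (LinearMap.range j).mkQ_surjective b
    obtain ⟨z, hz⟩ := hexB y hb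
    obtain ⟨c, rfl⟩ := hp z
    refine ⟨gA (x - a c), ?_⟩
    rw [hψ]
    rw [LinearMap.comp_apply, ← sub_eq_zero, ← map_sub, Submodule.mkQ_apply,
      Submodule.Quotient.mk_eq_zero]
    exact ⟨-c, by simp [j, hz]⟩
  · show Module.Projective R (PA × PB)
    infer_instance
  · intro c hc
    have h1 : a c = 0 := congrArg Prod.fst hc
    have h2 : fB (p c) = 0 := congrArg Prod.snd hc
    obtain ⟨y, rfl⟩ := hex c (hfB _ h2)
    rw [ha] at h1
    rw [hfA _ h1, map_zero]
  · exact (LinearMap.range j).mkQ_surjective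
  · intro c
    exact (Submodule.Quotient.mk_eq_zero _).2 ⟨c, rfl⟩
  · intro b hb
    exact (Submodule.Quotient.mk_eq_zero _).1 hb

lemma horseshoe_left {A C B A' B' : ModuleCat.{0} R} (i : A →ₗ[R] C) (p : C →ₗ[R] B)
    (h : SES i p) (hAA : Step A' A) (hBB : Step B' B) :
    ∃ (C' : ModuleCat.{0} R) (i' : A' →ₗ[R] C') (p' : C' →ₗ[R] B'), SES i' p' ∧ Step C' C := by
  obtain ⟨PA, fA, gA, hPA, hfA, hgA, hgfA, hexA⟩ := hAA
  obtain ⟨PB, fB, gB, hPB, hfB, hgB, hgfB, hexB⟩ := hBB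
  obtain ⟨hi, hp, hpi, hex⟩ := h
  obtain ⟨s, hs⟩ := lift_proj hPB p hp gB
  let t : (PA × PB) →ₗ[R] C := (i ∘ₗ gA).coprod s
  have ht : ∀ x y, t (x, y) = i (gA x) + s y := fun x y => by simp [t]
  have hpt : ∀ x y, p (t (x, y)) = gB y := fun x y => by simp [ht, hpi, hs]
  obtain ⟨p', hp'⟩ := factor_inj fB hfB (LinearMap.snd R PA PB ∘ₗ (LinearMap.ker t).subtype) (by
    rintro ⟨⟨x, y⟩, hz⟩
    apply hexB
    have := hpt x y
    rw [LinearMap.mem_ker.1 hz, map_zero] at this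
    exact this.symm)
  refine ⟨ModuleCat.of R (LinearMap.ker t),
    (LinearMap.inl R PA PB ∘ₗ fA).codRestrict (LinearMap.ker t) (fun a => by simp [ht, hgfA]),
    p', ⟨?_, ?_, ?_, ?_⟩,
    ModuleCat.of R (PA × PB), (LinearMap.ker t).subtype, t, ?_, ?_, ?_, ?_, ?_⟩
  · intro a ha
    apply hfA
    exact congrArg (fun x : LinearMap.ker t => x.1.1) ha
  · intro b
    obtain ⟨y, hy⟩ := hex (s (fB b)) (by rw [hs, hgfB])
    obtain ⟨x, rfl⟩ := hgA y
    refine ⟨⟨(-x, fB b), by simp [ht, hy]⟩, ?_⟩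
    apply sub_eq_zero.1
    apply hfB
    rw [map_sub, hp']
    simp
  · intro a
    apply hfB
    rw [hp']
    rfl
  · rintro ⟨⟨x, y⟩, hz⟩ hb
    have h1 := hp' ⟨⟨x, y⟩, hz⟩
    rw [hb, map_zero] at h1
    have h2 : y = 0 := h1.symm
    subst h2
    rw [LinearMap.mem_ker, ht, map_zero, add_zero] at hz
    obtain ⟨a, ha⟩ := hexA x (hi _ hz)
    exact ⟨a, Subtype.ext (Prod.ext ha rfl)⟩
  · show Module.Projective R (PA × PB)
    infer_instance
  · intro a ha
    exact Subtype.ext ha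
  · intro c
    obtain ⟨y, hy⟩ := hgB (p c)
    obtain ⟨a, ha⟩ := hex (c - s y) (by rw [map_sub, hs, hy, sub_self])
    obtain ⟨x, rfl⟩ := hgA a
    exact ⟨(x, y), by rw [ht, ha]; simp⟩
  · intro a
    exact a.2
  · intro b hb
    exact ⟨⟨b, hb⟩, rfl⟩

/-- Smallest class containing the retracts of `G`, closed under extensions. -/
inductive Cl (G : ModuleCat.{0} R) : ModuleCat.{0} R → Prop
  | base (M : ModuleCat.{0} R) (ι : M →ₗ[R] G) (π : G →ₗ[R] M) (h : ∀ m, π (ι m) = m) : Cl G M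
  | ext (A C B : ModuleCat.{0} R) (i : A →ₗ[R] C) (p : C →ₗ[R] B) (h : SES i p)
      (hA : Cl G A) (hB : Cl G B) : Cl G C

lemma Cl.V {G : ModuleCat.{0} R} (hG : V G) {M : ModuleCat.{0} R} (h : Cl G M) : V M := by
  induction h with
  | base M ι π h => exact V_retract ι π h hG
  | ext A C B i p h _ _ hA hB => exact V_ext i p h hA hB

lemma Cl.compl {G M : ModuleCat.{0} R} (ι : M →ₗ[R] G) (π : G →ₗ[R] M)
    (h : ∀ m, π (ι m) = m) : Cl G (ModuleCat.of R (LinearMap.ker π)) := by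
  refine Cl.base _ (LinearMap.ker π).subtype
    ((LinearMap.id - ι ∘ₗ π).codRestrict (LinearMap.ker π) (fun x => by simp [h])) ?_
  rintro ⟨x, hx⟩
  apply Subtype.ext
  simp [LinearMap.mem_ker.1 hx]

lemma Cl.right {G : ModuleCat.{0} R} (hG : GWaux.V G) (hs : Step G G) {M : ModuleCat.{0} R}
    (h : Cl G M) : ∃ M', Cl G M' ∧ Step M M' := by
  induction h with
  | base M ι π h =>
    obtain ⟨P, f, g, hP, hf, hg, hgf, hex⟩ := hs
    let j : M →ₗ[R] P := f ∘ₗ ι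
    let p' : (P ⧸ LinearMap.range j) →ₗ[R] G := (LinearMap.range j).liftQ g (by
      rintro _ ⟨c, rfl⟩
      simp [j, hgf])
    have hp' : ∀ x, p' ((LinearMap.range j).mkQ x) = g x := fun x => rfl
    refine ⟨ModuleCat.of R (P ⧸ LinearMap.range j), ?_, P, j, (LinearMap.range j).mkQ, hP,
      ?_, ?_, ?_, ?_⟩
    · refine Cl.ext (ModuleCat.of R (LinearMap.ker π)) _ G
        ((LinearMap.range j).mkQ ∘ₗ f ∘ₗ (LinearMap.ker π).subtype) p' ⟨?_, ?_, ?_, ?_⟩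
        (Cl.compl ι π h) (Cl.base _ LinearMap.id LinearMap.id (fun _ => rfl))
      · rintro ⟨x, hx⟩ h0
        obtain ⟨m, hm⟩ := (Submodule.Quotient.mk_eq_zero _).1 h0
        have h1 : ι m - x = 0 := hf _ (by rw [map_sub]; exact sub_eq_zero.2 hm)
        have h2 : ι m = x := sub_eq_zero.1 h1
        have h3 : m = 0 := by rw [← h m, h2]; exact hx
        apply Subtype.ext
        show x = 0
        rw [← h2, h3, map_zero]
      · intro x
        obtain ⟨y, rfl⟩ := hg x
        exact ⟨(LinearMap.range j).mkQ y, rfl⟩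
      · intro x
        exact hgf _
      · intro b hb
        obtain ⟨x, rfl⟩ := (LinearMap.range j).mkQ_surjective b
        obtain ⟨y, rfl⟩ := hex x hb
        refine ⟨⟨y - ι (π y), by simp [h]⟩, ?_⟩
        rw [← sub_eq_zero, LinearMap.comp_apply, ← map_sub]
        refine (Submodule.Quotient.mk_eq_zero _).2 ⟨-π y, ?_⟩
        simp [j]
    · intro m hm
      rw [← h m, hf _ hm, map_zero]
    · exact (LinearMap.range j).mkQ_surjective
    · intro c
      exact (Submodule.Quotient.mk_eq_zero _).2 ⟨c, rfl⟩
    · intro b hb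
      exact (Submodule.Quotient.mk_eq_zero _).1 hb
  | ext A C B i p h hA hB ihA ihB =>
    obtain ⟨A', hA', sA⟩ := ihA
    obtain ⟨B', hB', sB⟩ := ihB
    obtain ⟨C', i', p', hS, sC⟩ := horseshoe_right i p h (hB.V hG) sA sB
    exact ⟨C', Cl.ext A' C' B' i' p' hS hA' hB', sC⟩

lemma Cl.left {G : ModuleCat.{0} R} (hs : Step G G) {M : ModuleCat.{0} R}
    (h : Cl G M) : ∃ M', Cl G M' ∧ Step M' M := by
  induction h with
  | base M ι π h =>
    obtain ⟨P, f, g, hP, hf, hg, hgf, hex⟩ := hs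
    let t : P →ₗ[R] M := π ∘ₗ g
    refine ⟨ModuleCat.of R (LinearMap.ker t), ?_, P, (LinearMap.ker t).subtype, t, hP,
      ?_, ?_, ?_, ?_⟩
    · refine Cl.ext G _ (ModuleCat.of R (LinearMap.ker π))
        (f.codRestrict (LinearMap.ker t) (fun x => by simp [t, hgf]))
        ((g ∘ₗ (LinearMap.ker t).subtype).codRestrict (LinearMap.ker π) (fun x => x.2))
        ⟨?_, ?_, ?_, ?_⟩
        (Cl.base _ LinearMap.id LinearMap.id (fun _ => rfl)) (Cl.compl ι π h)
      · intro x hx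
        exact hf x (congrArg Subtype.val hx)
      · rintro ⟨x, hx⟩
        obtain ⟨y, rfl⟩ := hg x
        exact ⟨⟨y, hx⟩, rfl⟩
      · intro x
        exact Subtype.ext (hgf x)
      · rintro ⟨x, hx⟩ h0
        obtain ⟨y, hy⟩ := hex x (congrArg Subtype.val h0)
        exact ⟨y, Subtype.ext hy⟩
    · intro a ha
      exact Subtype.ext ha
    · intro c
      obtain ⟨y, hy⟩ := hg (ι c)
      exact ⟨y, by simp [t, hy, h]⟩
    · intro a
      exact a.2
    · intro b hb
      exact ⟨⟨b, hb⟩, rfl⟩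
  | ext A C B i p h hA hB ihA ihB =>
    obtain ⟨A', hA', sA⟩ := ihA
    obtain ⟨B', hB', sB⟩ := ihB
    obtain ⟨C', i', p', hS, sC⟩ := horseshoe_left i p h sA sB
    exact ⟨C', Cl.ext A' C' B' i' p' hS hA' hB', sC⟩

lemma exists_bi_seq {S : Type*} (r : S → S → Prop) (hr : ∀ s, ∃ t, r s t)
    (hl : ∀ t, ∃ s, r s t) (s₀ : S) : ∃ c : ℤ → S, c 0 = s₀ ∧ ∀ i, r (c i) (c (i + 1)) := by
  choose nx hnx using hr
  choose pv hpv using hl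
  refine ⟨fun i => match i with
    | Int.ofNat n => nx^[n] s₀
    | Int.negSucc n => pv^[n + 1] s₀, rfl, ?_⟩
  intro i
  match i with
  | Int.ofNat n =>
    show r (nx^[n] s₀) (nx^[n + 1] s₀)
    rw [Function.iterate_succ_apply']
    exact hnx _
  | Int.negSucc 0 => exact hpv s₀
  | Int.negSucc (n + 1) =>
    show r (pv^[n + 1 + 1] s₀) (pv^[n + 1] s₀)
    rw [Function.iterate_succ_apply' pv (n + 1)]
    exact hpv _

lemma Cl.gproj {G : ModuleCat.{0} R} (hG : GWaux.V G) (hs : Step G G) {M : ModuleCat.{0} R}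
    (h : Cl G M) : GW.IsGProj R M := by
  obtain ⟨c, hc0, hc⟩ := exists_bi_seq (S := {M // Cl G M}) (fun a b => Step a.1 b.1)
    (fun s => by
      obtain ⟨M', h1, h2⟩ := Cl.right hG hs s.2
      exact ⟨⟨M', h1⟩, h2⟩)
    (fun s => by
      obtain ⟨M', h1, h2⟩ := Cl.left hs s.2
      exact ⟨⟨M', h1⟩, h2⟩) ⟨M, h⟩
  choose P f g hP hS using hc
  have hd : ∀ i x, f (i + 1) (g i x) = 0 → g i x = 0 := fun i x hx => (hS (i + 1)).1 _ hx
  refine ⟨P, fun i => f (i + 1) ∘ₗ g i, hP, ?_, ?_, ?_⟩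
  · intro i x
    constructor
    · intro hx
      obtain ⟨y, rfl⟩ := (hS (i + 1)).2.2.2 x (hd _ _ hx)
      obtain ⟨z, rfl⟩ := (hS i).2.1 y
      exact ⟨z, rfl⟩
    · rintro ⟨y, rfl⟩
      simp [(hS (i + 1)).2.2.1]
  · intro Q hQ i φ
    constructor
    · intro hφ
      obtain ⟨ψ, hψ⟩ := factor_surj (g (i + 1)) (hS (i + 1)).2.1 φ (by
        intro x hx
        obtain ⟨y, rfl⟩ := (hS (i + 1)).2.2.2 x hx
        obtain ⟨z, rfl⟩ := (hS i).2.1 y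
        exact LinearMap.congr_fun hφ z)
      obtain ⟨χ, hχ⟩ := (c (i + 1 + 1 + 1)).2.V hG _ _ _ _ (hS (i + 1 + 1)) Q hQ ψ
      refine ⟨χ, ?_⟩
      ext x
      simp [hχ, hψ]
    · rintro ⟨χ, rfl⟩
      ext x
      simp [(hS (i + 1)).2.2.1]
  · have e1 : M = (c 0).1 := by rw [hc0]
    rw [e1]
    refine ⟨LinearEquiv.ofBijective ((f 0).codRestrict (LinearMap.ker (f (0 + 1) ∘ₗ g 0))
      (fun x => by simp [(hS 0).2.2.1])) ⟨?_, ?_⟩⟩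
    · rw [← LinearMap.ker_eq_bot, LinearMap.ker_eq_bot']
      intro m hm
      exact (hS 0).1 m (congrArg Subtype.val hm)
    · rintro ⟨x, hx⟩
      obtain ⟨y, hy⟩ := (hS 0).2.2.2 x (hd _ _ hx)
      exact ⟨y, Subtype.ext hy⟩

lemma sg_props {G : ModuleCat.{0} R} (h : GW.IsSGProj R G) : V G ∧ Step G G := by
  obtain ⟨P, f, hP, hf, hQ, ⟨e⟩⟩ := h
  let F : G →ₗ[R] P := (LinearMap.range f).subtype ∘ₗ e.toLinearMap
  let g : P →ₗ[R] G := e.symm.toLinearMap ∘ₗ f.rangeRestrict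
  have hFg : ∀ x, F (g x) = f x := by
    intro x
    simp [F, g]
  have hS : SES F g := by
    refine ⟨?_, ?_, ?_, ?_⟩
    · intro a ha
      have : e a = 0 := Subtype.ext ha
      simpa using this
    · intro y
      obtain ⟨x, hx⟩ := (e y).2
      refine ⟨x, ?_⟩
      apply e.injective
      apply Subtype.ext
      simp [g, hx]
    · intro a
      apply e.injective
      apply Subtype.ext
      obtain ⟨x, hx⟩ := (e a).2
      simp only [g, F, LinearMap.comp_apply, LinearEquiv.coe_coe, LinearEquiv.apply_symm_apply,
        Submodule.subtype_apply, ← hx, map_zero]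
      exact (hf _).2 ⟨x, rfl⟩
    · intro b hb
      have : f b = 0 := by rw [← hFg, hb, map_zero]
      obtain ⟨y, rfl⟩ := (hf b).1 this
      exact ⟨g y, hFg y⟩
  refine ⟨V_of_hext F g hS hP ?_, P, F, g, hP, hS⟩
  intro Q hQp φ
  obtain ⟨ψ, hψ⟩ := (hQ Q hQp (φ ∘ₗ g)).1 (by
    ext x
    have : g (f x) = 0 := by rw [← hFg, hS.2.2.1]
    simp [this])
  refine ⟨ψ, fun a => ?_⟩
  obtain ⟨x, rfl⟩ := hS.2.1 a
  rw [hFg]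
  exact LinearMap.congr_fun hψ x

open DirectSum in
lemma forward (M : ModuleCat.{0} R) (h : GW.IsGProj R M) :
    ∃ G : ModuleCat.{0} R, GW.IsSGProj R G ∧
      ∃ (i : M →ₗ[R] G) (p : G →ₗ[R] M), p.comp i = LinearMap.id := by
  obtain ⟨P, d, hP, hd, hQ, ⟨e⟩⟩ := h
  let D := ⨁ i, (P i : Type)
  let f : D →ₗ[R] D := DirectSum.toModule R ℤ D
    (fun i => DirectSum.lof R ℤ (fun i => (P i : Type)) (i + 1) ∘ₗ d i)
  have hfl : ∀ i x, f (DirectSum.lof R ℤ (fun i => (P i : Type)) i x) =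
      DirectSum.lof R ℤ (fun i => (P i : Type)) (i + 1) (d i x) := by
    intro i x
    exact DirectSum.toModule_lof R (M := fun i => (P i : Type)) (N := D)
      (φ := fun i => DirectSum.lof R ℤ (fun i => (P i : Type)) (i + 1) ∘ₗ d i) i x
  have hfc : ∀ (x : D) i, (f x) (i + 1) = d i (x i) := by
    intro x i
    induction x using DirectSum.induction_on with
    | zero => simp
    | of j y =>
      have := hfl j y
      rw [DirectSum.lof_eq_of] at this
      rw [this, DirectSum.lof_eq_of]
      by_cases hij : j = i
      · subst hij
        rw [DirectSum.of_eq_same, DirectSum.of_eq_same]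
      · rw [DirectSum.of_eq_of_ne _ _ _ (by omega), DirectSum.of_eq_of_ne _ _ _ (by omega),
          map_zero]
    | add x y hx hy =>
      rw [map_add, DirectSum.add_apply, hx, hy, DirectSum.add_apply, map_add]
  have hsucc : ∀ j : ℤ, ∃ i, j = i + 1 := fun j => ⟨j - 1, by omega⟩
  have hff : ∀ x, f (f x) = 0 := by
    intro x
    refine DFinsupp.ext fun j => ?_
    obtain ⟨j, rfl⟩ := hsucc j
    obtain ⟨j, rfl⟩ := hsucc j
    rw [hfc, hfc]
    exact (hd _ _).2 ⟨_, rfl⟩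
  have hker : ∀ x, f x = 0 → x ∈ LinearMap.range f := by
    intro x hx
    classical
    rw [← DirectSum.sum_support_of x]
    refine Submodule.sum_mem _ fun j _ => ?_
    obtain ⟨i, rfl⟩ := hsucc j
    obtain ⟨y, hy⟩ := (hd i (x (i + 1))).1 (by rw [← hfc, hx]; rfl)
    refine ⟨DirectSum.lof R ℤ (fun i => (P i : Type)) i y, ?_⟩
    rw [hfl, hy]
    rfl
  refine ⟨ModuleCat.of R (LinearMap.range f), ⟨ModuleCat.of R D, f, ?_, ?_, ?_,
    ⟨LinearEquiv.refl R _⟩⟩, ?_⟩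
  · show Module.Projective R (⨁ i, (P i : Type))
    infer_instance
  · intro x
    constructor
    · intro hx
      exact hker x hx
    · rintro ⟨y, rfl⟩
      exact hff y
  · intro Q hQp φ
    constructor
    · intro hφ
      have hφ' : ∀ x, φ (f x) = 0 := fun x => LinearMap.congr_fun hφ x
      have key : ∀ k, ∃ h : P k →ₗ[R] Q, ∀ i (hk : i + 1 = k) (x : P i),
          h (hk ▸ d i x) = φ (DirectSum.lof R ℤ (fun i => (P i : Type)) i x) := by
        intro k
        obtain ⟨k, rfl⟩ := hsucc k
        obtain ⟨k, rfl⟩ := hsucc k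
        obtain ⟨h, hh⟩ := (hQ Q hQp k
          (φ ∘ₗ DirectSum.lof R ℤ (fun i => (P i : Type)) (k + 1))).1 (by
            ext x
            have := hφ' (DirectSum.lof R ℤ (fun i => (P i : Type)) k x)
            rw [hfl] at this
            exact this)
        refine ⟨h, fun i hk x => ?_⟩
        obtain rfl : i = k + 1 := by omega
        exact LinearMap.congr_fun hh x
      choose h hh using key
      refine ⟨DirectSum.toModule R ℤ Q h, ?_⟩
      refine DirectSum.linearMap_ext R fun i => ?_
      ext x
      have h1 := hh (i + 1) i rfl x
      show DirectSum.toModule R ℤ Q h (f (DirectSum.lof R ℤ (fun i => (P i : Type)) i x)) = _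
      rw [hfl, DirectSum.toModule_lof]
      exact h1
    · rintro ⟨χ, rfl⟩
      ext x
      show χ (f (f _)) = 0
      rw [hff, map_zero]
  · refine ⟨(DirectSum.lof R ℤ (fun i => (P i : Type)) 0 ∘ₗ (LinearMap.ker (d 0)).subtype ∘ₗ
      e.toLinearMap).codRestrict (LinearMap.range f) ?_,
      e.symm.toLinearMap ∘ₗ (DirectSum.component R ℤ (fun i => (P i : Type)) 0 ∘ₗ
        (LinearMap.range f).subtype).codRestrict (LinearMap.ker (d 0)) ?_, ?_⟩
    · intro m
      apply hker
      have := (e m).2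
      rw [LinearMap.mem_ker] at this
      simp only [LinearMap.comp_apply, hfl]
      simp [this]
    · rintro ⟨_, ⟨y, rfl⟩⟩
      rw [LinearMap.mem_ker]
      show d 0 ((f y) 0) = 0
      rw [← hfc, hff]
      rfl
    · ext m
      apply e.injective
      apply Subtype.ext
      simp [DirectSum.component.lof_self]

end GWaux

/-- a module is Gorenstein projective iff it is a direct summand of a strongly
Gorenstein projective module. -/
theorem stmt5 (R : Type) [CommRing R] (M : ModuleCat.{0} R) :
    GW.IsGProj R M ↔
      ∃ G : ModuleCat.{0} R, GW.IsSGProj R G ∧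
        ∃ (i : M →ₗ[R] G) (p : G →ₗ[R] M), p.comp i = LinearMap.id := by
  constructor
  · exact GWaux.forward M
  · rintro ⟨G, hG, i, p, hip⟩
    obtain ⟨hV, hS⟩ := GWaux.sg_props hG
    exact (GWaux.Cl.base M i p (fun m => LinearMap.congr_fun hip m)).gproj hV hS
end
end

section
/- Let R be a coherent commutative ring, X an indeterminate, and M a finitely presented R[[X]]-module such that X is a nonzero divisor on M and R[[X]] is coherent. Then the Gorenstein projective dimension of M over R[[X]] is at most the Gorenstein projective dimension of M/XM over R. -/
open CategoryTheory

noncomputable section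

namespace GWX

section Gen

variable {R : Type} [CommRing R]

/-- Factor a (semilinear) map through a surjection. -/
lemma factor_surj {S : Type} [CommRing S] {σ : S →+* R} (hσ : Function.Surjective σ)
    {W V Q : Type} [AddCommGroup W] [Module S W] [AddCommGroup V] [Module R V]
    [AddCommGroup Q] [Module R Q] (h : W →ₛₗ[σ] V) (hs : Function.Surjective h)
    (χ : W →ₛₗ[σ] Q) (hk : ∀ w, h w = 0 → χ w = 0) :
    ∃ ψ : V →ₗ[R] Q, ∀ w, ψ (h w) = χ w := by
  have key : ∀ w w', h w = h w' → χ w = χ w' := fun w w' e => by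
    have := hk (w - w') (by rw [map_sub, e, sub_self])
    rwa [map_sub, sub_eq_zero] at this
  refine ⟨{ toFun := fun v => χ (Function.surjInv hs v), map_add' := ?_, map_smul' := ?_ }, ?_⟩
  · intro x y
    rw [← map_add]
    apply key
    simp [Function.surjInv_eq hs]
  · intro r x
    obtain ⟨s, rfl⟩ := hσ r
    rw [RingHom.id_apply, ← map_smulₛₗ]
    apply key
    simp [Function.surjInv_eq hs]
  · intro w
    exact key _ _ (Function.surjInv_eq hs _)

lemma factor_surj' {W V Q : Type} [AddCommGroup W] [Module R W] [AddCommGroup V] [Module R V]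
    [AddCommGroup Q] [Module R Q] (h : W →ₗ[R] V) (hs : Function.Surjective h)
    (χ : W →ₗ[R] Q) (hk : ∀ w, h w = 0 → χ w = 0) :
    ∃ ψ : V →ₗ[R] Q, ∀ w, ψ (h w) = χ w :=
  factor_surj (σ := RingHom.id R) Function.surjective_id h hs χ hk

/-- Factor a map through an injection. -/
lemma factor_inj {W A B : Type} [AddCommGroup W] [Module R W] [AddCommGroup A] [Module R A]
    [AddCommGroup B] [Module R B] (j : A →ₗ[R] B) (hj : Function.Injective j)
    (φ : W →ₗ[R] B) (hr : ∀ w, ∃ a, j a = φ w) :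
    ∃ θ : W →ₗ[R] A, ∀ w, j (θ w) = φ w := by
  choose θ hθ using hr
  refine ⟨{ toFun := θ, map_add' := ?_, map_smul' := ?_ }, hθ⟩
  · intro x y
    apply hj
    simp [hθ]
  · intro r x
    apply hj
    simp [hθ]

/-- short exact sequences -/
structure SES {A B C : Type} [AddCommGroup A] [Module R A] [AddCommGroup B] [Module R B]
    [AddCommGroup C] [Module R C] (f : A →ₗ[R] B) (g : B →ₗ[R] C) : Prop where
  inj : Function.Injective f
  zero : ∀ a, g (f a) = 0
  ex : ∀ b, g b = 0 → ∃ a, f a = b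
  surj : Function.Surjective g

variable (R) in
/-- vanishing of `Ext^1(G, projective)` -/
def E1 (G : Type) [AddCommGroup G] [Module R G] : Prop :=
  ∀ (U V Q : Type) [AddCommGroup U] [Module R U] [AddCommGroup V] [Module R V]
    [AddCommGroup Q] [Module R Q], Module.Projective R Q →
    ∀ (j : U →ₗ[R] V) (s : V →ₗ[R] G), SES j s → ∀ φ : U →ₗ[R] Q,
      ∃ ψ : V →ₗ[R] Q, ∀ u, ψ (j u) = φ u

lemma e1_of_cover {G K F : Type} [AddCommGroup G] [Module R G] [AddCommGroup K] [Module R K]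
    [AddCommGroup F] [Module R F] [Module.Projective R F] (κ : K →ₗ[R] F) (π : F →ₗ[R] G)
    (h : SES κ π)
    (H : ∀ (Q : Type) [AddCommGroup Q] [Module R Q], Module.Projective R Q →
      ∀ φ : K →ₗ[R] Q, ∃ ψ : F →ₗ[R] Q, ∀ u, ψ (κ u) = φ u) : E1 R G := by
  intro U V Q _ _ _ _ _ _ hQ j s hjs φ
  obtain ⟨t, ht⟩ := Module.projective_lifting_property s π hjs.surj
  replace ht : ∀ x, s (t x) = π x := fun x => LinearMap.congr_fun ht x
  obtain ⟨θ, hθ⟩ := factor_inj j hjs.inj (t ∘ₗ κ) (fun w => hjs.ex _ (by simp [ht, h.zero]))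
  obtain ⟨ψ0, hψ0⟩ := H Q hQ (φ ∘ₗ θ)
  obtain ⟨ψ, hψ⟩ := factor_surj' (j.coprod t) (by
      intro v
      obtain ⟨x, hx⟩ := h.surj (s v)
      obtain ⟨u, hu⟩ := hjs.ex (v - t x) (by simp [ht, hx])
      exact ⟨(u, x), by simp [hu]⟩) (φ.coprod ψ0) (by
      rintro ⟨u, x⟩ hux
      simp only [LinearMap.coprod_apply] at hux ⊢
      have h1 : π x = 0 := by
        have := congrArg s hux
        simpa [ht, hjs.zero] using this
      obtain ⟨k, rfl⟩ := h.ex _ h1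
      have h2 : u + θ k = 0 := hjs.inj (by
        rw [map_add, map_zero, hθ]; exact hux)
      rw [hψ0, LinearMap.comp_apply, ← map_add, h2, map_zero])
  refine ⟨ψ, fun u => ?_⟩
  have := hψ (u, 0)
  simpa using this

lemma e1_ext {A B C : Type} [AddCommGroup A] [Module R A] [AddCommGroup B] [Module R B]
    [AddCommGroup C] [Module R C] (f : A →ₗ[R] B) (g : B →ₗ[R] C) (h : SES f g)
    (hA : E1 R A) (hC : E1 R C) : E1 R B := by
  intro U V Q _ _ _ _ _ _ hQ j s hjs φ
  let VA : Submodule R V := LinearMap.ker (g ∘ₗ s)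
  obtain ⟨s', hs'⟩ := factor_inj f h.inj (s ∘ₗ VA.subtype) (fun w => h.ex _ w.2)
  obtain ⟨ψ1, hψ1⟩ := hA U VA Q hQ
    (j.codRestrict VA (fun u => by simp [VA, hjs.zero])) s'
    ⟨fun x y hxy => hjs.inj (congrArg Subtype.val hxy),
      fun a => h.inj (by simp [hs', hjs.zero]),
      fun b hb => by
        obtain ⟨u, hu⟩ := hjs.ex b.1 (by
          have := hs' b
          rw [hb, map_zero] at this
          exact this.symm)
        exact ⟨u, Subtype.ext hu⟩,
      fun a => by
        obtain ⟨v, hv⟩ := hjs.surj (f a)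
        exact ⟨⟨v, by simp [VA, hv, h.zero]⟩, h.inj (by simp [hs', hv])⟩⟩ φ
  obtain ⟨ψ, hψ⟩ := hC VA V Q hQ VA.subtype (g ∘ₗ s)
    ⟨Subtype.val_injective, fun a => a.2, fun b hb => ⟨⟨b, hb⟩, rfl⟩, h.surj.comp hjs.surj⟩ ψ1
  exact ⟨ψ, fun u => (hψ ⟨j u, by simp [VA, hjs.zero]⟩).trans (hψ1 u)⟩

lemma e1_retract {A B : Type} [AddCommGroup A] [Module R A] [AddCommGroup B] [Module R B]
    (i : A →ₗ[R] B) (p : B →ₗ[R] A) (hip : ∀ a, p (i a) = a) (hB : E1 R B) : E1 R A := by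
  intro U V Q _ _ _ _ _ _ hQ j s hjs φ
  -- pull back along `p`
  let W : Submodule R (V × B) := LinearMap.ker (s.coprod (-p))
  have hW : ∀ w : W, s w.1.1 = p w.1.2 := fun w => by
    have h1 : s w.1.1 + -p w.1.2 = 0 := w.2
    rwa [← sub_eq_add_neg, sub_eq_zero] at h1
  obtain ⟨ψ, hψ⟩ := hB U W Q hQ
    ((LinearMap.inl R V B ∘ₗ j).codRestrict W (fun u => by simp [W, hjs.zero]))
    (LinearMap.snd R V B ∘ₗ W.subtype)
    ⟨fun x y hxy => hjs.inj (congrArg (fun w : W => w.1.1) hxy),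
      fun a => rfl,
      fun b hb => by
        have hb' : b.1.2 = 0 := hb
        obtain ⟨u, hu⟩ := hjs.ex b.1.1 (by rw [hW, hb', map_zero])
        exact ⟨u, Subtype.ext (Prod.ext hu hb'.symm)⟩,
      fun b => by
        obtain ⟨v, hv⟩ := hjs.surj (p b)
        exact ⟨⟨(v, b), by simp [W, hv]⟩, rfl⟩⟩ φ
  refine ⟨ψ ∘ₗ (LinearMap.prod LinearMap.id (i ∘ₗ s)).codRestrict W
    (fun v => by simp [W, hip]), fun u => ?_⟩
  rw [← hψ u, LinearMap.comp_apply]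
  congr 1
  apply Subtype.ext
  refine Prod.ext rfl ?_
  have : i (s (j u)) = 0 := by rw [hjs.zero, map_zero]
  exact this

lemma e1_proj {A : Type} [AddCommGroup A] [Module R A] [Module.Projective R A] : E1 R A := by
  refine e1_of_cover (0 : PUnit →ₗ[R] A) LinearMap.id
    ⟨fun _ _ _ => rfl, fun a => by simp, fun b hb => ⟨0, by simpa using hb.symm⟩,
      Function.surjective_id⟩ ?_
  intro Q _ _ _ φ
  exact ⟨0, fun u => (map_zero φ).symm⟩

/-- a class of modules closed under (co)syzygies and with `Ext^1` vanishing -/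
structure Good (PP : ModuleCat.{0} R → Prop) : Prop where
  e1 : ∀ M, PP M → E1 R M
  right : ∀ M, PP M → ∃ (P G : ModuleCat.{0} R) (f : M →ₗ[R] P) (g : P →ₗ[R] G),
    Module.Projective R P ∧ SES f g ∧ PP G
  left : ∀ M, PP M → ∃ (P G : ModuleCat.{0} R) (f : G →ₗ[R] P) (g : P →ₗ[R] M),
    Module.Projective R P ∧ SES f g ∧ PP G

variable (R) in
/-- the largest good class -/
def GP (M : Type) [AddCommGroup M] [Module R M] : Prop :=
  ∃ PP : ModuleCat.{0} R → Prop, Good PP ∧ PP (ModuleCat.of R M)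

lemma GP.e1 {M : Type} [AddCommGroup M] [Module R M] (h : GP R M) : E1 R M := by
  obtain ⟨PP, h1, h2⟩ := h
  exact h1.e1 _ h2

lemma GP.right {M : Type} [AddCommGroup M] [Module R M] (h : GP R M) :
    ∃ (P G : ModuleCat.{0} R) (f : M →ₗ[R] P) (g : P →ₗ[R] G),
    Module.Projective R P ∧ SES f g ∧ GP R G := by
  obtain ⟨PP, h1, h2⟩ := h
  obtain ⟨P, G, f, g, hP, hfg, hG⟩ := h1.right _ h2
  exact ⟨P, G, f, g, hP, hfg, PP, h1, hG⟩

lemma GP.left {M : Type} [AddCommGroup M] [Module R M] (h : GP R M) :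
    ∃ (P G : ModuleCat.{0} R) (f : G →ₗ[R] P) (g : P →ₗ[R] M),
    Module.Projective R P ∧ SES f g ∧ GP R G := by
  obtain ⟨PP, h1, h2⟩ := h
  obtain ⟨P, G, f, g, hP, hfg, hG⟩ := h1.left _ h2
  exact ⟨P, G, f, g, hP, hfg, PP, h1, hG⟩

lemma good_proj : Good (fun M : ModuleCat.{0} R => Module.Projective R M) where
  e1 _ _ := e1_proj
  right M hM := ⟨M, ModuleCat.of R PUnit, LinearMap.id, 0, hM,
    ⟨Function.injective_id, fun _ => rfl, fun b _ => ⟨b, rfl⟩, fun _ => ⟨0, rfl⟩⟩,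
    inferInstanceAs (Module.Projective R PUnit)⟩
  left M hM := ⟨M, ModuleCat.of R PUnit, 0, LinearMap.id, hM,
    ⟨fun _ _ _ => rfl, fun _ => rfl, fun _ hb => ⟨0, hb.symm⟩, Function.surjective_id⟩,
    inferInstanceAs (Module.Projective R PUnit)⟩

lemma gp_proj {M : Type} [AddCommGroup M] [Module R M] [h : Module.Projective R M] : GP R M :=
  ⟨_, good_proj, h⟩

lemma gp_retract {G P A : Type} [AddCommGroup G] [Module R G] [AddCommGroup P] [Module R P]
    [AddCommGroup A] [Module R A] (hG : GP R G) (hP : Module.Projective R P)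
    (i : A →ₗ[R] G × P) (p : G × P →ₗ[R] A) (hip : ∀ a, p (i a) = a) : GP R A := by
  refine ⟨fun A => ∃ (G P : ModuleCat.{0} R) (i : A →ₗ[R] G × P) (p : G × P →ₗ[R] A),
    GP R G ∧ Module.Projective R P ∧ ∀ a, p (i a) = a, ⟨?_, ?_, ?_⟩,
    ⟨ModuleCat.of R G, ModuleCat.of R P, i, p, hG, hP, hip⟩⟩
  · rintro A ⟨G, P, i, p, hG, hP, hip⟩
    refine e1_retract i p hip (e1_ext (LinearMap.inl R G P) (LinearMap.snd R G P)
      ⟨LinearMap.inl_injective, fun a => rfl, ?_, LinearMap.snd_surjective⟩ hG.e1 e1_proj)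
    rintro ⟨a, b⟩ hb
    exact ⟨a, Prod.ext rfl hb.symm⟩
  · rintro A ⟨G, P0, i, p, hG, hP0, hip⟩
    obtain ⟨P1, G', j1, q1, hP1, h1, hG'⟩ := hG.right
    let j : G × P0 →ₗ[R] P1 × P0 := j1.prodMap LinearMap.id
    let q : P1 × P0 →ₗ[R] G' := q1 ∘ₗ LinearMap.fst R P1 P0
    have hjq : SES j q := by
      refine ⟨?_, ?_, ?_, ?_⟩
      · rintro ⟨a, b⟩ ⟨c, d⟩ hab
        simp only [j, LinearMap.prodMap_apply, Prod.mk.injEq, LinearMap.id_apply] at hab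
        exact Prod.ext (h1.inj hab.1) hab.2
      · rintro ⟨a, b⟩
        simp [j, q, h1.zero]
      · rintro ⟨a, b⟩ hab
        obtain ⟨x, hx⟩ := h1.ex a hab
        exact ⟨(x, b), by simp [j, hx]⟩
      · exact h1.surj.comp LinearMap.fst_surjective
    obtain ⟨e, he⟩ := hG'.e1 _ _ (P1 × P0) inferInstance j q hjq (j ∘ₗ i ∘ₗ p)
    let N := LinearMap.range (j ∘ₗ i)
    have hinj : Function.Injective (j ∘ₗ i) := by
      refine hjq.inj.comp (Function.LeftInverse.injective hip)
    refine ⟨ModuleCat.of R (P1 × P0), ModuleCat.of R ((P1 × P0) ⧸ N), j ∘ₗ i, N.mkQ,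
      inferInstanceAs (Module.Projective R (P1 × P0)), ⟨hinj, ?_, ?_, N.mkQ_surjective⟩, ?_⟩
    · intro a
      exact (Submodule.Quotient.mk_eq_zero N).2 ⟨a, rfl⟩
    · intro b hb
      exact (Submodule.Quotient.mk_eq_zero N).1 hb
    · obtain ⟨r, hr⟩ := factor_surj' q hjq.surj (N.mkQ ∘ₗ e) (by
        intro w hw
        obtain ⟨x, rfl⟩ := hjq.ex w hw
        rw [LinearMap.comp_apply, he]
        exact (Submodule.Quotient.mk_eq_zero N).2 ⟨p x, rfl⟩)
      refine ⟨G', ModuleCat.of R (P1 × P0),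
        N.liftQ (LinearMap.prod q (LinearMap.id - e)) ?_, r.coprod N.mkQ, hG',
        inferInstanceAs (Module.Projective R (P1 × P0)), ?_⟩
      · rintro _ ⟨a, rfl⟩
        have h2 : e (j (i a)) = j (i a) := by rw [he]; simp [hip]
        simp [hjq.zero, h2]
      · intro a
        obtain ⟨x, rfl⟩ := N.mkQ_surjective a
        have h3 : r (q x) = N.mkQ (e x) := hr x
        have : r (q x) + N.mkQ (x - e x) = N.mkQ x := by rw [h3, map_sub]; abel
        exact this
  · rintro A ⟨G, P0, i, p, hG, hP0, hip⟩
    obtain ⟨P1, G', u1, v1, hP1, h1, hG'⟩ := hG.left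
    let v : P1 × P0 →ₗ[R] G × P0 := v1.prodMap LinearMap.id
    let u : G' →ₗ[R] P1 × P0 := LinearMap.inl R P1 P0 ∘ₗ u1
    have huv : SES u v := by
      refine ⟨LinearMap.inl_injective.comp h1.inj, ?_, ?_, ?_⟩
      · intro a
        simp [u, v, h1.zero]
      · rintro ⟨a, b⟩ hab
        simp only [v, LinearMap.prodMap_apply, Prod.mk_eq_zero, LinearMap.id_apply] at hab
        obtain ⟨x, hx⟩ := h1.ex a hab.1
        exact ⟨x, by simp [u, hx, hab.2]⟩
      · rintro ⟨a, b⟩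
        obtain ⟨x, hx⟩ := h1.surj a
        exact ⟨(x, b), by simp [v, hx]⟩
    obtain ⟨e, he⟩ := Module.projective_lifting_property v (i ∘ₗ p ∘ₗ v) huv.surj
    replace he : ∀ x, v (e x) = i (p (v x)) := fun x => LinearMap.congr_fun he x
    let K := LinearMap.ker (p ∘ₗ v)
    have hpv : Function.Surjective (p ∘ₗ v) :=
      (Function.RightInverse.surjective hip).comp huv.surj
    refine ⟨ModuleCat.of R (P1 × P0), ModuleCat.of R K, K.subtype, p ∘ₗ v,
      inferInstanceAs (Module.Projective R (P1 × P0)),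
      ⟨Subtype.val_injective, fun a => a.2, fun b hb => ⟨⟨b, hb⟩, rfl⟩, hpv⟩, ?_⟩
    obtain ⟨r, hr⟩ := factor_inj u huv.inj (e ∘ₗ K.subtype) (fun w => huv.ex _ (by
      have : p (v w) = 0 := w.2
      simp [he, this]))
    refine ⟨G', ModuleCat.of R (P1 × P0), LinearMap.prod r K.subtype,
      (u.coprod (LinearMap.id - e)).codRestrict K ?_, hG',
        inferInstanceAs (Module.Projective R (P1 × P0)), ?_⟩
    · rintro ⟨a, b⟩
      simp [K, huv.zero, he, hip]
    · intro a
      apply Subtype.ext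
      have h3 : u (r a) = e a := hr a
      have : u (r a) + (a.1 - e a) = a.1 := by rw [h3]; abel
      exact this

lemma gp_ext {A B C : Type} [AddCommGroup A] [Module R A] [AddCommGroup B] [Module R B]
    [AddCommGroup C] [Module R C] (f : A →ₗ[R] B) (g : B →ₗ[R] C) (h : SES f g)
    (hA : GP R A) (hC : GP R C) : GP R B := by
  refine ⟨fun B => ∃ (A C : ModuleCat.{0} R) (f : A →ₗ[R] B) (g : B →ₗ[R] C),
    SES f g ∧ GP R A ∧ GP R C, ⟨?_, ?_, ?_⟩,
    ⟨ModuleCat.of R A, ModuleCat.of R C, f, g, h, hA, hC⟩⟩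
  · rintro B ⟨A, C, f, g, h, hA, hC⟩
    exact e1_ext f g h hA.e1 hC.e1
  · rintro B ⟨A, C, f, g, h, hA, hC⟩
    obtain ⟨PA, A', a, a', hPA, h1, hA'⟩ := hA.right
    obtain ⟨PC, C', c, c', hPC, h2, hC'⟩ := hC.right
    obtain ⟨t, ht⟩ := hC.e1 _ _ PA hPA f g h a
    let k : B →ₗ[R] PA × PC := LinearMap.prod t (c ∘ₗ g)
    have hk : Function.Injective k := by
      rw [injective_iff_map_eq_zero]
      intro b hb
      simp only [k, LinearMap.prod_apply, Function.prod, Prod.mk_eq_zero, LinearMap.comp_apply] at hb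
      have h3 : g b = 0 := h2.inj (by rw [hb.2, map_zero])
      obtain ⟨x, rfl⟩ := h.ex b h3
      have h4 : x = 0 := h1.inj (by rw [← ht, hb.1, map_zero])
      rw [h4, map_zero]
    let N := LinearMap.range k
    refine ⟨ModuleCat.of R (PA × PC), ModuleCat.of R ((PA × PC) ⧸ N), k, N.mkQ,
      inferInstanceAs (Module.Projective R (PA × PC)), ⟨hk, ?_, ?_, N.mkQ_surjective⟩, ?_⟩
    · intro a
      exact (Submodule.Quotient.mk_eq_zero N).2 ⟨a, rfl⟩
    · intro b hb
      exact (Submodule.Quotient.mk_eq_zero N).1 hb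
    · obtain ⟨f', hf'⟩ := factor_surj' a' h1.surj (N.mkQ ∘ₗ LinearMap.inl R PA PC) (by
        intro w hw
        obtain ⟨x, rfl⟩ := h1.ex w hw
        exact (Submodule.Quotient.mk_eq_zero N).2 ⟨f x, by simp [k, ht, h.zero]⟩)
      let g' := N.liftQ (c' ∘ₗ LinearMap.snd R PA PC) (by
        rintro _ ⟨b, rfl⟩
        simp [k, h2.zero])
      refine ⟨A', C', f', g', ⟨?_, ?_, ?_, ?_⟩, hA', hC'⟩
      · rw [injective_iff_map_eq_zero]
        intro y hy
        obtain ⟨x, rfl⟩ := h1.surj y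
        rw [hf'] at hy
        obtain ⟨b, hb⟩ := (Submodule.Quotient.mk_eq_zero N).1 hy
        simp only [k, LinearMap.prod_apply, Function.prod, LinearMap.comp_apply,
          LinearMap.inl_apply, Prod.mk.injEq] at hb
        have h3 : g b = 0 := h2.inj (by rw [hb.2, map_zero])
        obtain ⟨x, rfl⟩ := h.ex b h3
        rw [← hb.1, ht, h1.zero]
      · intro y
        obtain ⟨x, rfl⟩ := h1.surj y
        rw [hf']
        simp [g']
      · intro y hy
        obtain ⟨⟨x, z⟩, rfl⟩ := N.mkQ_surjective y
        obtain ⟨w, hw⟩ := h2.ex z (by simpa [g'] using hy)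
        obtain ⟨b, hb⟩ := h.surj w
        refine ⟨a' (x - t b), ?_⟩
        rw [hf']
        refine (Submodule.Quotient.eq N).2 ⟨-b, ?_⟩
        simp [k, hb, hw]
      · intro y
        obtain ⟨x, rfl⟩ := h2.surj y
        exact ⟨N.mkQ (0, x), by simp [g']⟩
  · rintro B ⟨A, C, f, g, h, hA, hC⟩
    obtain ⟨PA, A', a', a, hPA, h1, hA'⟩ := hA.left
    obtain ⟨PC, C', c', c, hPC, h2, hC'⟩ := hC.left
    obtain ⟨t, ht⟩ := Module.projective_lifting_property g c h.surj
    replace ht : ∀ x, g (t x) = c x := fun x => LinearMap.congr_fun ht x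
    let k : PA × PC →ₗ[R] B := (f ∘ₗ a).coprod t
    have hk : Function.Surjective k := by
      intro b
      obtain ⟨y, hy⟩ := h2.surj (g b)
      obtain ⟨z, hz⟩ := h.ex (b - t y) (by simp [ht, hy])
      obtain ⟨x, hx⟩ := h1.surj z
      exact ⟨(x, y), by simp [k, hx, hz]⟩
    let N := LinearMap.ker k
    refine ⟨ModuleCat.of R (PA × PC), ModuleCat.of R N, N.subtype, k,
      inferInstanceAs (Module.Projective R (PA × PC)),
      ⟨Subtype.val_injective, fun a => a.2, fun b hb => ⟨⟨b, hb⟩, rfl⟩, hk⟩, ?_⟩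
    have hN : ∀ w : N, f (a w.1.1) + t w.1.2 = 0 := fun w => w.2
    obtain ⟨g', hg'⟩ := factor_inj c' h2.inj (LinearMap.snd R PA PC ∘ₗ N.subtype) (by
      intro w
      apply h2.ex
      have := congrArg g (hN w)
      simpa [h.zero, ht] using this)
    replace hg' : ∀ w : N, c' (g' w) = w.1.2 := hg'
    let f' : A' →ₗ[R] N := (LinearMap.inl R PA PC ∘ₗ a').codRestrict N (by
      intro x; simp [N, k, h1.zero])
    refine ⟨A', C', f', g', ⟨?_, ?_, ?_, ?_⟩, hA', hC'⟩
    · intro x y hxy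
      exact h1.inj (congrArg (fun w : N => w.1.1) hxy)
    · intro x
      apply h2.inj
      rw [hg', map_zero]
      rfl
    · intro w hw
      have h3 : w.1.2 = 0 := by rw [← hg', hw, map_zero]
      have h4 : a w.1.1 = 0 := h.inj (by
        have := hN w
        rwa [h3, map_zero, add_zero, ← map_zero f] at this)
      obtain ⟨x, hx⟩ := h1.ex _ h4
      exact ⟨x, Subtype.ext (Prod.ext hx h3.symm)⟩
    · intro z
      obtain ⟨y, hy⟩ := h.ex (-(t (c' z))) (by simp [ht, h2.zero])
      obtain ⟨x, hx⟩ := h1.surj y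
      refine ⟨⟨(x, c' z), by simp [N, k, hx, hy]⟩, ?_⟩
      apply h2.inj
      rw [hg']

lemma gp_ker {A B C : Type} [AddCommGroup A] [Module R A] [AddCommGroup B] [Module R B]
    [AddCommGroup C] [Module R C] (f : A →ₗ[R] B) (g : B →ₗ[R] C) (h : SES f g)
    (hB : GP R B) (hC : GP R C) : GP R A := by
  obtain ⟨PC, C', c', c, hPC, h2, hC'⟩ := hC.left
  obtain ⟨t, ht⟩ := Module.projective_lifting_property g c h.surj
  replace ht : ∀ x, g (t x) = c x := fun x => LinearMap.congr_fun ht x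
  obtain ⟨θ, hθ⟩ := factor_inj f h.inj (t ∘ₗ c') (fun w => h.ex _ (by simp [ht, h2.zero]))
  replace hθ : ∀ w, f (θ w) = t (c' w) := hθ
  have hS : SES (LinearMap.prod (-θ) c') (f.coprod t) := by
    refine ⟨?_, ?_, ?_, ?_⟩
    · intro x y hxy
      exact h2.inj (congrArg Prod.snd hxy)
    · intro x
      simp [hθ]
    · rintro ⟨x, y⟩ hxy
      simp only [LinearMap.coprod_apply] at hxy
      obtain ⟨z, rfl⟩ := h2.ex y (by
        have := congrArg g hxy
        simpa [h.zero, ht] using this)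
      refine ⟨z, Prod.ext (h.inj ?_) rfl⟩
      have : f (-θ z) = f x := by
        rw [map_neg, hθ]
        exact (eq_neg_of_add_eq_zero_left hxy).symm
      exact this
    · intro b
      obtain ⟨y, hy⟩ := h2.surj (g b)
      obtain ⟨z, hz⟩ := h.ex (b - t y) (by simp [ht, hy])
      exact ⟨(z, y), by simp [hz]⟩
  have hAP : GP R (A × PC) := gp_ext _ _ hS hC' hB
  exact gp_retract (P := PUnit) hAP inferInstance
    (LinearMap.inl R _ _ ∘ₗ LinearMap.inl R A PC)
    (LinearMap.fst R _ _ ∘ₗ LinearMap.fst R _ _) (fun a => rfl)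

/-- cokernels of projective preenvelopes -/
lemma gp_coker {N P0 : Type} [AddCommGroup N] [Module R N] [AddCommGroup P0] [Module R P0]
    (hN : GP R N) (hP0 : Module.Projective R P0) (e : N →ₗ[R] P0)
    (H : ∀ (Q : Type) [AddCommGroup Q] [Module R Q], Module.Projective R Q →
      ∀ φ : N →ₗ[R] Q, ∃ ψ : P0 →ₗ[R] Q, ∀ u, ψ (e u) = φ u) :
    Function.Injective e ∧ GP R (P0 ⧸ LinearMap.range e) := by
  obtain ⟨P, N', j, q, hP, hjq, hN'⟩ := hN.right
  obtain ⟨t, ht⟩ := H P hP j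
  obtain ⟨w, hw⟩ := hN'.e1 _ _ P0 hP0 j q hjq e
  constructor
  · intro x y hxy
    apply hjq.inj
    rw [← ht, ← ht, hxy]
  · set D := LinearMap.range e
    obtain ⟨r, hr⟩ := factor_surj' q hjq.surj (D.mkQ ∘ₗ w) (by
      intro y hy
      obtain ⟨x, rfl⟩ := hjq.ex y hy
      rw [LinearMap.comp_apply, hw]
      exact (Submodule.Quotient.mk_eq_zero D).2 ⟨x, rfl⟩)
    refine gp_retract hN' hP0 (D.liftQ (LinearMap.prod (q ∘ₗ t) (LinearMap.id - w ∘ₗ t)) ?_)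
      (r.coprod D.mkQ) ?_
    · rintro _ ⟨a, rfl⟩
      simp [ht, hjq.zero, hw]
    · intro a
      obtain ⟨x, rfl⟩ := D.mkQ_surjective a
      have h3 : r (q (t x)) = D.mkQ (w (t x)) := hr (t x)
      have : r (q (t x)) + D.mkQ (x - w (t x)) = D.mkQ x := by rw [h3, map_sub]; abel
      exact this

end Gen

section Conv

variable {R : Type} [CommRing R]

lemma gp_of_isGProj (M : ModuleCat.{0} R) (h : GW.IsGProj R M) : GP R M := by
  obtain ⟨P, d, hP, hd, hQ, ⟨e⟩⟩ := h
  have dd : ∀ i x, d (i + 1) (d i x) = 0 := fun i x => (hd i _).2 ⟨x, rfl⟩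
  -- the short exact sequences
  have ses : ∀ i, ∃ g : P i →ₗ[R] LinearMap.ker (d (i + 1)),
      SES (LinearMap.ker (d i)).subtype g ∧ ∀ x, (g x : P (i + 1)) = d i x := by
    intro i
    refine ⟨(d i).codRestrict _ (fun x => dd i x),
      ⟨Subtype.val_injective, fun a => Subtype.ext a.2,
        fun b hb => ⟨⟨b, congrArg Subtype.val hb⟩, rfl⟩, ?_⟩, fun x => rfl⟩
    rintro ⟨y, hy⟩
    obtain ⟨x, hx⟩ := (hd i y).1 hy
    exact ⟨x, Subtype.ext hx⟩
  have hker : ∀ j, E1 R (LinearMap.ker (d j)) := by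
    intro j
    obtain ⟨i, rfl⟩ : ∃ i : ℤ, j = i + 1 + 1 := ⟨j - 1 - 1, by ring⟩
    obtain ⟨g, hg, hgd⟩ := ses (i + 1)
    have := hP (i + 1)
    refine e1_of_cover _ g hg ?_
    intro Q _ _ hQp φ
    obtain ⟨g0, hg0, hgd0⟩ := ses i
    obtain ⟨k, rfl⟩ : ∃ k : ℤ, i = k + 1 := ⟨i - 1, by ring⟩
    obtain ⟨ψ, hψ⟩ := (hQ (ModuleCat.of R Q) hQp k (φ ∘ₗ g0)).1 (by
      ext x
      have : g0 (d k x) = 0 := Subtype.ext (by rw [hgd0, dd]; rfl)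
      simp [this])
    refine ⟨ψ, fun u => ?_⟩
    obtain ⟨x, rfl⟩ := hg0.surj u
    have := LinearMap.congr_fun hψ x
    simp only [LinearMap.comp_apply] at this
    rw [← this, Submodule.subtype_apply, hgd0]
  refine ⟨fun Z => ∃ j, Nonempty (Z ≃ₗ[R] LinearMap.ker (d j)), ⟨?_, ?_, ?_⟩, ⟨0, ⟨e⟩⟩⟩
  · rintro Z ⟨j, ⟨e⟩⟩
    exact e1_retract e.toLinearMap e.symm.toLinearMap (fun a => by simp) (hker j)
  · rintro Z ⟨j, ⟨e⟩⟩
    obtain ⟨g, hg, -⟩ := ses j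
    refine ⟨P j, ModuleCat.of R (LinearMap.ker (d (j + 1))),
      (LinearMap.ker (d j)).subtype ∘ₗ e.toLinearMap, g, hP j,
      ⟨hg.inj.comp e.injective, fun a => hg.zero _, ?_, hg.surj⟩, j + 1, ⟨LinearEquiv.refl _ _⟩⟩
    intro b hb
    obtain ⟨a, rfl⟩ := hg.ex b hb
    exact ⟨e.symm a, by simp⟩
  · rintro Z ⟨j, ⟨e⟩⟩
    obtain ⟨i, rfl⟩ : ∃ i : ℤ, j = i + 1 := ⟨j - 1, by ring⟩
    obtain ⟨g, hg, -⟩ := ses i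
    refine ⟨P i, ModuleCat.of R (LinearMap.ker (d i)),
      (LinearMap.ker (d i)).subtype, e.symm.toLinearMap ∘ₗ g, hP i,
      ⟨hg.inj, fun a => ?_, ?_, e.symm.surjective.comp hg.surj⟩, i, ⟨LinearEquiv.refl _ _⟩⟩
    · rw [LinearMap.comp_apply, hg.zero, map_zero]
    · intro b hb
      exact hg.ex b (e.symm.injective (by simpa using hb))

lemma isGProj_of_good (PP : ModuleCat.{0} R → Prop) (h : Good PP) (M : ModuleCat.{0} R)
    (hM : PP M) : GW.IsGProj R M := by
  let Lk (A C : ModuleCat.{0} R) : Prop :=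
    ∃ (P : ModuleCat.{0} R) (f : A →ₗ[R] P) (g : P →ₗ[R] C), Module.Projective R P ∧ SES f g
  have hr : ∀ A : {A // PP A}, ∃ C : {A // PP A}, Lk A.1 C.1 := by
    rintro ⟨A, hA⟩
    obtain ⟨P, G, f, g, h1, h2, h3⟩ := h.right A hA
    exact ⟨⟨G, h3⟩, P, f, g, h1, h2⟩
  have hl : ∀ A : {A // PP A}, ∃ C : {A // PP A}, Lk C.1 A.1 := by
    rintro ⟨A, hA⟩
    obtain ⟨P, G, f, g, h1, h2, h3⟩ := h.left A hA
    exact ⟨⟨G, h3⟩, P, f, g, h1, h2⟩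
  choose r hr using hr
  choose l hl using hl
  let rr : ℕ → {A // PP A} := fun n => Nat.rec ⟨M, hM⟩ (fun _ A => r A) n
  let ll : ℕ → {A // PP A} := fun n => Nat.rec ⟨M, hM⟩ (fun _ A => l A) n
  let Z : ℤ → {A // PP A} := fun i => Int.rec (fun n => rr n) (fun n => ll (n + 1)) i
  have hZ : ∀ i : ℤ, Lk (Z i).1 (Z (i + 1)).1 := by
    intro i
    rcases i with n | n
    · exact hr (rr n)
    · cases n with
      | zero => exact hl (ll 0)
      | succ n =>
        have e : Int.negSucc (n + 1) + 1 = Int.negSucc n := by omega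
        rw [e]
        exact hl (ll (n + 1))
  choose P f g hP hfg using hZ
  refine ⟨P, fun i => f (i + 1) ∘ₗ g i, hP, ?_, ?_, ?_⟩
  · intro i y
    constructor
    · intro hy
      have h1 : g (i + 1) y = 0 := (hfg (i + 1 + 1)).inj (by
        rw [map_zero]; exact hy)
      obtain ⟨z, rfl⟩ := (hfg (i + 1)).ex y h1
      obtain ⟨x, rfl⟩ := (hfg i).surj z
      exact ⟨x, rfl⟩
    · rintro ⟨x, rfl⟩
      simp [(hfg (i + 1)).zero]
  · intro Q hQ i φ
    constructor
    · intro hφ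
      obtain ⟨φ', hφ'⟩ := factor_surj' (g (i + 1)) (hfg (i + 1)).surj φ (by
        intro y hy
        obtain ⟨z, rfl⟩ := (hfg (i + 1)).ex y hy
        obtain ⟨x, rfl⟩ := (hfg i).surj z
        exact LinearMap.congr_fun hφ x)
      obtain ⟨ψ, hψ⟩ := h.e1 _ (Z (i + 1 + 1 + 1)).2 _ _ Q hQ _ _ (hfg (i + 1 + 1)) φ'
      refine ⟨ψ, ?_⟩
      ext x
      simp [hψ, hφ']
    · rintro ⟨ψ, rfl⟩
      ext x
      simp [(hfg (i + 1)).zero]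
  · refine ⟨LinearEquiv.ofBijective ((f 0).codRestrict _ ?_) ⟨?_, ?_⟩⟩
    · intro x
      simp [(hfg 0).zero]
    · intro x y hxy
      exact (hfg 0).inj (congrArg Subtype.val hxy)
    · rintro ⟨y, hy⟩
      obtain ⟨z, hz⟩ := (hfg 0).ex y ((hfg (0 + 1)).inj (by
        rw [map_zero]; exact hy))
      exact ⟨z, Subtype.ext hz⟩

/-- Gorenstein projective dimension with respect to `GP`. -/
def dimLE (R : Type) [CommRing R] : ℕ → ModuleCat.{0} R → Prop
  | 0, M => GP R M
  | (n + 1), M => ∃ (K G : ModuleCat.{0} R) (f : K →ₗ[R] G) (g : G →ₗ[R] M),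
      GP R G ∧ SES f g ∧ dimLE R n K

lemma dimLE_of_gpdLE (n : ℕ) : ∀ M : ModuleCat.{0} R, GW.gpdLE R n M → dimLE R n M := by
  induction n with
  | zero => exact fun M h => gp_of_isGProj M h
  | succ n ih =>
    rintro M ⟨K, G, f, g, hG, hf, hg, hfg, hK⟩
    exact ⟨K, G, f, g, gp_of_isGProj G hG, ⟨hf, fun a => (hfg _).2 ⟨a, rfl⟩,
      fun b hb => (hfg b).1 hb, hg⟩, ih K hK⟩

/-- adding a projective summand and passing to the kernel of a map onto a `GP` -/
lemma dimLE_ker (n : ℕ) : ∀ (A B C : ModuleCat.{0} R) (f : A →ₗ[R] B) (g : B →ₗ[R] C),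
    SES f g → dimLE R n B → GP R C → dimLE R n A := by
  intro A B C f g h hB hC
  cases n with
  | zero => exact gp_ker f g h hB hC
  | succ n =>
    obtain ⟨K, G, u, v, hG, huv, hK⟩ := hB
    let G1 := LinearMap.ker (g ∘ₗ v)
    have hG1 : GP R G1 := gp_ker G1.subtype (g ∘ₗ v)
      ⟨Subtype.val_injective, fun a => a.2, fun b hb => ⟨⟨b, hb⟩, rfl⟩, h.surj.comp huv.surj⟩
      hG hC
    obtain ⟨v', hv'⟩ := factor_inj f h.inj (v ∘ₗ G1.subtype) (fun w => h.ex _ w.2)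
    replace hv' : ∀ w : G1, f (v' w) = v w := hv'
    refine ⟨K, ModuleCat.of R G1, u.codRestrict G1 (fun x => by simp [G1, huv.zero]), v', hG1,
      ⟨?_, ?_, ?_, ?_⟩, hK⟩
    · intro x y hxy
      exact huv.inj (congrArg Subtype.val hxy)
    · intro a
      apply h.inj
      exact (hv' _).trans ((huv.zero a).trans (map_zero f).symm)
    · intro w hw
      obtain ⟨x, hx⟩ := huv.ex w.1 (by rw [← hv', hw, map_zero])
      exact ⟨x, Subtype.ext hx⟩
    · intro a
      obtain ⟨x, hx⟩ := huv.surj (f a)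
      refine ⟨⟨x, by simp [G1, hx, h.zero]⟩, h.inj ?_⟩
      rw [hv']
      exact hx

lemma dimLE_prod (n : ℕ) (A F : ModuleCat.{0} R) (hA : dimLE R n A)
    (hF : Module.Projective R F) : dimLE R n (ModuleCat.of R (A × F)) := by
  have key : ∀ G : ModuleCat.{0} R, GP R G → GP R (G × F) := fun G hG =>
    gp_retract hG hF LinearMap.id LinearMap.id (fun _ => rfl)
  cases n with
  | zero => exact key A hA
  | succ n =>
    obtain ⟨K, G, u, v, hG, huv, hK⟩ := hA
    refine ⟨K, ModuleCat.of R (G × F), LinearMap.inl R G F ∘ₗ u, v.prodMap LinearMap.id,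
      key G hG, ⟨LinearMap.inl_injective.comp huv.inj, ?_, ?_, ?_⟩, hK⟩
    · intro a
      simp [huv.zero]
    · rintro ⟨a, b⟩ hab
      have h1 : v a = 0 := congrArg Prod.fst hab
      have h2 : b = 0 := congrArg Prod.snd hab
      obtain ⟨x, hx⟩ := huv.ex a h1
      exact ⟨x, Prod.ext hx h2.symm⟩
    · rintro ⟨a, b⟩
      obtain ⟨x, hx⟩ := huv.surj a
      exact ⟨(x, b), Prod.ext hx rfl⟩

lemma dimLE_syz (n : ℕ) (K1 F N : ModuleCat.{0} R) (κ : K1 →ₗ[R] F) (π : F →ₗ[R] N)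
    (h : SES κ π) (hF : Module.Projective R F) (hN : dimLE R (n + 1) N) : dimLE R n K1 := by
  obtain ⟨K, G, f, g, hG, hfg, hK⟩ := hN
  obtain ⟨t, ht⟩ := Module.projective_lifting_property g π hfg.surj
  replace ht : ∀ x, g (t x) = π x := fun x => LinearMap.congr_fun ht x
  obtain ⟨θ, hθ⟩ := factor_inj f hfg.inj (t ∘ₗ κ) (fun w => hfg.ex _ (by simp [ht, h.zero]))
  replace hθ : ∀ w, f (θ w) = t (κ w) := hθ
  refine dimLE_ker n K1 (ModuleCat.of R (K × F)) G (LinearMap.prod (-θ) κ) (f.coprod t) ?_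
    (dimLE_prod n K F hK hF) hG
  refine ⟨?_, ?_, ?_, ?_⟩
  · intro x y hxy
    exact h.inj (congrArg Prod.snd hxy)
  · intro x
    have : f (-θ x) + t (κ x) = 0 := by rw [map_neg, hθ]; simp
    exact this
  · rintro ⟨x, y⟩ hxy
    replace hxy : f x + t y = 0 := hxy
    obtain ⟨z, rfl⟩ := h.ex y (by
      have := congrArg g hxy
      simpa [hfg.zero, ht] using this)
    refine ⟨z, Prod.ext (hfg.inj ?_) rfl⟩
    have : f (-θ z) = f x := by
      rw [map_neg, hθ]
      exact (eq_neg_of_add_eq_zero_left hxy).symm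
    exact this
  · intro b
    obtain ⟨y, hy⟩ := h.surj (g b)
    obtain ⟨z, hz⟩ := hfg.ex (b - t y) (by simp [ht, hy])
    refine ⟨(z, y), ?_⟩
    have : f z + t y = b := by rw [hz]; abel
    exact this

end Conv

section Coh

variable {S : Type} [CommRing S]

lemma coh_fin (hS : GW.IsCoherentRing S) (m : ℕ) : ∀ (A : Type) [AddCommGroup A] [Module S A],
    Module.Finite S A → ∀ f : A →ₗ[S] (Fin m → S), Function.Injective f →
    Module.FinitePresentation S A := by
  induction m with
  | zero =>
    intro A _ _ _ f hf
    have : Subsingleton A := hf.subsingleton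
    infer_instance
  | succ m ih =>
    intro A _ _ hA f hf
    let f0 : A →ₗ[S] S := LinearMap.proj 0 ∘ₗ f
    have hI : Module.FinitePresentation S (LinearMap.range f0) :=
      hS (LinearMap.range f0) (Module.Finite.iff_fg.1 inferInstance)
    have hk : (LinearMap.ker f0.rangeRestrict).FG :=
      Module.FinitePresentation.fg_ker f0.rangeRestrict f0.surjective_rangeRestrict
    have hk' : Module.FinitePresentation S (LinearMap.ker f0.rangeRestrict) := by
      refine ih _ (Module.Finite.iff_fg.2 hk)
        (LinearMap.funLeft S S Fin.succ ∘ₗ f ∘ₗ Submodule.subtype _) ?_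
      intro x y hxy
      apply Subtype.ext
      apply hf
      funext i
      refine Fin.cases ?_ (fun i => congrFun hxy i) i
      have hx : f0 x.1 = 0 := congrArg Subtype.val x.2
      have hy : f0 y.1 = 0 := congrArg Subtype.val y.2
      exact hx.trans hy.symm
    exact Module.finitePresentation_of_ker f0.rangeRestrict f0.surjective_rangeRestrict

lemma coh_ker (hS : GW.IsCoherentRing S) {A : Type} [AddCommGroup A] [Module S A]
    [Module.Finite S A] {m : ℕ} (f : A →ₗ[S] (Fin m → S)) : (LinearMap.ker f).FG := by
  have : Module.FinitePresentation S (LinearMap.range f) :=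
    coh_fin hS m _ inferInstance (LinearMap.range f).subtype Subtype.val_injective
  have := Module.FinitePresentation.fg_ker f.rangeRestrict f.surjective_rangeRestrict
  rwa [LinearMap.ker_rangeRestrict] at this

lemma coh_hom (hS : GW.IsCoherentRing S) {A : Type} [AddCommGroup A] [Module S A]
    [hA : Module.FinitePresentation S A] : Module.Finite S (A →ₗ[S] S) := by
  obtain ⟨n, K, e, hK⟩ := Module.FinitePresentation.exists_fin S A
  obtain ⟨m, v, hv⟩ := Submodule.fg_iff_exists_fin_generating_family.1 hK
  -- functionals on `S^n` vanishing on `v`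
  let ev : ((Fin n → S) →ₗ[S] S) →ₗ[S] (Fin m → S) :=
    LinearMap.pi (fun i => LinearMap.applyₗ (v i))
  have h1 : (LinearMap.ker ev).FG := coh_ker hS ev
  have : Module.Finite S (LinearMap.ker ev) := Module.Finite.iff_fg.2 h1
  have hev : ∀ φ : LinearMap.ker ev, K ≤ LinearMap.ker φ.1 := by
    intro φ
    rw [← hv, Submodule.span_le]
    rintro _ ⟨i, rfl⟩
    exact congrFun φ.2 i
  let T : LinearMap.ker ev →ₗ[S] (A →ₗ[S] S) :=
    { toFun := fun φ => K.liftQ φ.1 (hev φ) ∘ₗ e.toLinearMap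
      map_add' := fun φ ψ => by
        ext a
        obtain ⟨x, hx⟩ := K.mkQ_surjective (e a)
        simp [← hx]
      map_smul' := fun s φ => by
        ext a
        obtain ⟨x, hx⟩ := K.mkQ_surjective (e a)
        simp [← hx] }
  refine Module.Finite.of_surjective T ?_
  intro φ
  refine ⟨⟨φ ∘ₗ e.symm.toLinearMap ∘ₗ K.mkQ, ?_⟩, ?_⟩
  · rw [LinearMap.mem_ker]
    funext i
    have : K.mkQ (v i) = 0 := by
      rw [← LinearMap.mem_ker, K.ker_mkQ, ← hv]
      exact Submodule.subset_span ⟨i, rfl⟩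
    simp only [ev, LinearMap.pi_apply, LinearMap.applyₗ_apply_apply, LinearMap.comp_apply, this]
    simp
  · ext a
    obtain ⟨x, hx⟩ := K.mkQ_surjective (e a)
    have : e.symm (K.mkQ x) = a := by rw [hx]; simp
    simp only [T, LinearMap.coe_mk, AddHom.coe_mk, LinearMap.comp_apply,
      LinearEquiv.coe_coe, ← hx, Submodule.mkQ_apply, Submodule.liftQ_apply]
    exact congrArg φ this

/-- extending functionals on a finite module suffices for extending maps to projectives -/
lemma ext_proj {A B : Type} [AddCommGroup A] [Module S A] [AddCommGroup B] [Module S B]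
    [hA : Module.Finite S A] (j : A →ₗ[S] B)
    (H : ∀ φ : A →ₗ[S] S, ∃ ψ : B →ₗ[S] S, ∀ a, ψ (j a) = φ a)
    (Q : Type) [AddCommGroup Q] [Module S Q] (hQ : Module.Projective S Q) (φ : A →ₗ[S] Q) :
    ∃ ψ : B →ₗ[S] Q, ∀ a, ψ (j a) = φ a := by
  classical
  obtain ⟨s, hs⟩ := Module.projective_def.1 hQ
  let φ' := s ∘ₗ φ
  obtain ⟨t, ht⟩ := hA.fg_top
  let T : Finset Q := t.biUnion (fun a => (φ' a).support)
  have hT : ∀ a, φ' a ∈ Finsupp.supported S S (T : Set Q) := by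
    intro a
    have h1 : (⊤ : Submodule S A) ≤ (Finsupp.supported S S (T : Set Q)).comap φ' := by
      rw [← ht, Submodule.span_le]
      intro a ha
      rw [SetLike.mem_coe, Submodule.mem_comap, Finsupp.mem_supported]
      intro x hx
      exact Finset.mem_coe.2 (Finset.mem_biUnion.2 ⟨a, ha, hx⟩)
    exact h1 trivial
  choose ψ hψ using fun q : Q => H (Finsupp.lapply q ∘ₗ φ')
  refine ⟨Finsupp.linearCombination S id ∘ₗ (∑ q ∈ T, Finsupp.lsingle q ∘ₗ ψ q), fun a => ?_⟩
  have : (∑ q ∈ T, Finsupp.lsingle q ∘ₗ ψ q) (j a) = φ' a := by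
    have h2 : φ' a = ∑ q ∈ T, Finsupp.single q (φ' a q) := by
      have := Finsupp.sum_of_support_subset (φ' a)
        (Finset.coe_subset.1 ((Finsupp.mem_supported S _).1 (hT a)))
        (fun q x => Finsupp.single q x) (by simp)
      rw [Finsupp.sum_single] at this
      exact this
    rw [LinearMap.sum_apply, h2]
    refine Finset.sum_congr rfl (fun q _ => ?_)
    simp [hψ]
  rw [LinearMap.comp_apply, this]
  exact hs (φ a)

end Coh

section PS

open PowerSeries

variable {R : Type} [CommRing R]

lemma cc_surj : Function.Surjective (constantCoeff (R := R)) := constantCoeff_surj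

lemma X_jac : Ideal.span {(X : PowerSeries R)} ≤ Ideal.jacobson ⊥ := by
  rw [Ideal.span_le, Set.singleton_subset_iff, SetLike.mem_coe, Ideal.mem_jacobson_bot]
  intro y
  rw [isUnit_iff_constantCoeff]
  simp

/-- `ρ : K → N` exhibits `N` as `K / X K`. -/
structure Bar {K N : Type} [AddCommGroup K] [Module (PowerSeries R) K] [AddCommGroup N]
    [Module R N] (ρ : K →ₛₗ[constantCoeff (R := R)] N) : Prop where
  surj : Function.Surjective ρ
  ker : ∀ k, ρ k = 0 → ∃ k', k = (X : PowerSeries R) • k'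

lemma bar_zero {K N : Type} [AddCommGroup K] [Module (PowerSeries R) K] [AddCommGroup N]
    [Module R N] (ρ : K →ₛₗ[constantCoeff (R := R)] N) (k : K) :
    ρ ((X : PowerSeries R) • k) = 0 := by
  rw [map_smulₛₗ]; simp

variable (R) in
/-- reduction of the free module -/
def rhoF (n : ℕ) : (Fin n → PowerSeries R) →ₛₗ[constantCoeff (R := R)] (Fin n → R) where
  toFun x i := constantCoeff (x i)
  map_add' x y := by ext i; simp
  map_smul' s x := by ext i; simp

lemma bar_F (n : ℕ) : Bar (rhoF R n) := by
  refine ⟨fun y => ⟨fun i => C (y i), by ext i; simp [rhoF]⟩, fun k hk => ?_⟩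
  have : ∀ i, ∃ y, k i = X * y := fun i => X_dvd_iff.2 (congrFun hk i)
  choose y hy using this
  exact ⟨y, by ext1 i; simp [hy]⟩

lemma reg_F (n : ℕ) (v : Fin n → PowerSeries R) (h : (X : PowerSeries R) • v = 0) : v = 0 := by
  ext1 i
  have : X * v i = X * 0 := by rw [mul_zero]; exact congrFun h i
  exact X_mul_cancel this

lemma lift_F (n : ℕ) (χ : (Fin n → PowerSeries R) →ₛₗ[constantCoeff (R := R)] R) :
    ∃ ψ : (Fin n → PowerSeries R) →ₗ[PowerSeries R] PowerSeries R,
      ∀ x, constantCoeff (ψ x) = χ x := by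
  refine ⟨∑ i, (LinearMap.proj i).smulRight (C (χ (Pi.single i 1))), fun x => ?_⟩
  conv_rhs => rw [pi_eq_sum_univ' x]
  rw [map_sum, LinearMap.sum_apply, map_sum]
  refine Finset.sum_congr rfl (fun i _ => ?_)
  rw [map_smulₛₗ]
  have : (fun j => if j = i then (1 : PowerSeries R) else 0) = Pi.single i 1 := by
    ext1 j; simp [Pi.single_apply]
  simp [this]

lemma divX {A : Type} [AddCommGroup A] [Module (PowerSeries R) A]
    (φ : A →ₗ[PowerSeries R] PowerSeries R) (h : ∀ a, constantCoeff (φ a) = 0) :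
    ∃ φ1 : A →ₗ[PowerSeries R] PowerSeries R, ∀ a, X * φ1 a = φ a :=
  factor_inj (LinearMap.lsmul (PowerSeries R) (PowerSeries R) X)
    (fun _ _ h => X_mul_cancel h) φ (fun w => by
      obtain ⟨y, hy⟩ := X_dvd_iff.2 (h w)
      exact ⟨y, hy.symm⟩)

/-- syzygies and reduction modulo `X` -/
lemma syz (hS : GW.IsCoherentRing (PowerSeries R)) {K N : Type} [AddCommGroup K]
    [Module (PowerSeries R) K] [AddCommGroup N] [Module R N]
    [Module.FinitePresentation (PowerSeries R) K]
    (hreg : ∀ k : K, (X : PowerSeries R) • k = 0 → k = 0)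
    (ρ : K →ₛₗ[constantCoeff (R := R)] N) (hρ : Bar ρ) :
    ∃ (n : ℕ) (π : (Fin n → PowerSeries R) →ₗ[PowerSeries R] K) (π' : (Fin n → R) →ₗ[R] N)
      (ρ' : LinearMap.ker π →ₛₗ[constantCoeff (R := R)] LinearMap.ker π'),
      Function.Surjective π ∧ Function.Surjective π' ∧
      Module.FinitePresentation (PowerSeries R) (LinearMap.ker π) ∧
      (∀ x, π' (rhoF R n x) = ρ (π x)) ∧ Bar ρ' ∧ ∀ k, (ρ' k).1 = rhoF R n k.1 := by
  obtain ⟨n, π, hπ⟩ := Module.Finite.exists_fin' (PowerSeries R) K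
  obtain ⟨π', hπ'⟩ := factor_surj cc_surj (rhoF R n) (bar_F n).surj (ρ.comp π) (by
    intro w hw
    obtain ⟨y, rfl⟩ := (bar_F n).ker w hw
    rw [LinearMap.comp_apply, map_smul, bar_zero])
  replace hπ' : ∀ x, π' (rhoF R n x) = ρ (π x) := hπ'
  have hfg : (LinearMap.ker π).FG := Module.FinitePresentation.fg_ker π hπ
  let ρ' : LinearMap.ker π →ₛₗ[constantCoeff (R := R)] LinearMap.ker π' :=
    { toFun := fun k => ⟨rhoF R n k.1, by
        have : π k.1 = 0 := k.2
        rw [LinearMap.mem_ker, hπ', this, map_zero]⟩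
      map_add' := fun x y => Subtype.ext (map_add (rhoF R n) _ _)
      map_smul' := fun s y => Subtype.ext (map_smulₛₗ (rhoF R n) _ _) }
  refine ⟨n, π, π', ρ', hπ, ?_, ?_, hπ', ⟨?_, ?_⟩, fun k => rfl⟩
  · intro y
    obtain ⟨k, rfl⟩ := hρ.surj y
    obtain ⟨x, rfl⟩ := hπ k
    exact ⟨_, hπ' x⟩
  · exact coh_fin hS n _ (Module.Finite.iff_fg.2 hfg) (LinearMap.ker π).subtype
      Subtype.val_injective
  · rintro ⟨y, hy⟩
    obtain ⟨x, rfl⟩ := (bar_F n).surj y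
    rw [LinearMap.mem_ker, hπ'] at hy
    obtain ⟨k, hk⟩ := hρ.ker _ hy
    obtain ⟨x', rfl⟩ := hπ k
    refine ⟨⟨x - (X : PowerSeries R) • x', ?_⟩, Subtype.ext ?_⟩
    · rw [LinearMap.mem_ker, map_sub, map_smul, hk, sub_self]
    · change rhoF R n (x - (X : PowerSeries R) • x') = rhoF R n x
      rw [map_sub, bar_zero, sub_zero]
  · rintro ⟨x, hx⟩ h
    obtain ⟨y, rfl⟩ := (bar_F n).ker x (congrArg Subtype.val h)
    rw [LinearMap.mem_ker, map_smul] at hx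
    exact ⟨⟨y, hreg _ hx⟩, rfl⟩

/-- extension of functionals from the syzygy -/
lemma ext_ker (hS : GW.IsCoherentRing (PowerSeries R)) {N : Type}
    [AddCommGroup N] [Module R N] (hN : E1 R N)
    {n : ℕ} {D : Submodule (PowerSeries R) (Fin n → PowerSeries R)} {π' : (Fin n → R) →ₗ[R] N}
    (ρ' : D →ₛₗ[constantCoeff (R := R)] LinearMap.ker π')
    (hπ' : Function.Surjective π') (hfp : Module.FinitePresentation (PowerSeries R) D)
    (hb : Bar ρ') (hr : ∀ k, (ρ' k).1 = rhoF R n k.1)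
    (φ : D →ₗ[PowerSeries R] PowerSeries R) :
    ∃ ψ : (Fin n → PowerSeries R) →ₗ[PowerSeries R] PowerSeries R, ∀ k : D, ψ k.1 = φ k := by
  have hfin : Module.Finite (PowerSeries R) (D →ₗ[PowerSeries R] PowerSeries R) := coh_hom hS
  let res : ((Fin n → PowerSeries R) →ₗ[PowerSeries R] PowerSeries R) →ₗ[PowerSeries R]
      (D →ₗ[PowerSeries R] PowerSeries R) := LinearMap.lcomp _ _ D.subtype
  have key : (⊤ : Submodule (PowerSeries R) (D →ₗ[PowerSeries R] PowerSeries R)) ≤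
      LinearMap.range res := by
    refine Submodule.le_of_le_smul_of_le_jacobson_bot hfin.fg_top X_jac ?_
    intro φ _
    let cc : PowerSeries R →ₛₗ[constantCoeff (R := R)] R :=
      { toFun := fun s => constantCoeff s
        map_add' := fun x y => by simp
        map_smul' := fun x y => by simp }
    obtain ⟨φ', hφ'⟩ := factor_surj cc_surj ρ' hb.surj (cc.comp φ) (by
      intro w hw
      obtain ⟨y, rfl⟩ := hb.ker w hw
      rw [LinearMap.comp_apply, map_smul, bar_zero])
    obtain ⟨ψ', hψ'⟩ := hN _ _ R inferInstance (LinearMap.ker π').subtype π'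
      ⟨Subtype.val_injective, fun a => a.2, fun b hb => ⟨⟨b, hb⟩, rfl⟩, hπ'⟩ φ'
    obtain ⟨ψ, hψ⟩ := lift_F n (ψ'.comp (rhoF R n))
    obtain ⟨φ1, hφ1⟩ := divX (φ - res ψ) (by
      intro a
      have h1 : constantCoeff (ψ a.1) = constantCoeff (φ a) := by
        rw [hψ, LinearMap.comp_apply, ← hr]
        exact (hψ' (ρ' a)).trans (hφ' a)
      have h2 : (φ - res ψ) a = φ a - ψ a.1 := rfl
      rw [h2, map_sub, h1, sub_self])
    have h3 : φ = res ψ + (X : PowerSeries R) • φ1 := by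
      ext1 a
      have := hφ1 a
      rw [LinearMap.sub_apply] at this
      rw [LinearMap.add_apply, LinearMap.smul_apply, smul_eq_mul, this]
      abel
    rw [h3]
    exact Submodule.add_mem_sup ⟨ψ, rfl⟩
      (Submodule.smul_mem_smul (Ideal.mem_span_singleton_self X) trivial)
  obtain ⟨ψ, hψ⟩ := key (show φ ∈ ⊤ from trivial)
  exact ⟨ψ, fun k => LinearMap.congr_fun hψ k⟩

/-- The class of finitely presented `X`-regular modules with `GP` reduction. -/
def Cls (K : ModuleCat.{0} (PowerSeries R)) : Prop :=
  Module.FinitePresentation (PowerSeries R) K ∧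
  (∀ k : K, (X : PowerSeries R) • k = 0 → k = 0) ∧
  ∃ (N : ModuleCat.{0} R) (ρ : K →ₛₗ[constantCoeff (R := R)] N), Bar ρ ∧ GP R N

lemma good_cls (hS : GW.IsCoherentRing (PowerSeries R)) :
    Good (Cls (R := R)) := by
  refine ⟨?_, ?_, ?_⟩
  · rintro K ⟨hfp, hreg, N, ρ, hρ, hN⟩
    obtain ⟨n, π, π', ρ', h1, h2, h3, h4, h5, h6⟩ := syz hS hreg ρ hρ
    refine e1_of_cover (LinearMap.ker π).subtype π
      ⟨Subtype.val_injective, fun a => a.2, fun b hb => ⟨⟨b, hb⟩, rfl⟩, h1⟩ ?_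
    intro Q _ _ hQ φ
    exact ext_proj (LinearMap.ker π).subtype (ext_ker hS hN.e1 ρ' h2 h3 h5 h6) Q hQ φ
  · rintro K ⟨hfp, hreg, N, ρ, hρ, hN⟩
    obtain ⟨n, π, π', ρ', h1, h2, h3, h4, h5, h6⟩ := syz hS hreg ρ hρ
    have hfin : Module.Finite (PowerSeries R) (K →ₗ[PowerSeries R] PowerSeries R) := coh_hom hS
    obtain ⟨m, v, hv⟩ := Submodule.fg_iff_exists_fin_generating_family.1 hfin.fg_top
    let e : K →ₗ[PowerSeries R] (Fin m → PowerSeries R) := LinearMap.pi v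
    obtain ⟨e', he'⟩ := factor_surj cc_surj ρ hρ.surj ((rhoF R m).comp e) (by
      intro w hw
      obtain ⟨y, rfl⟩ := hρ.ker w hw
      rw [LinearMap.comp_apply, map_smul, bar_zero])
    replace he' : ∀ k, e' (ρ k) = rhoF R m (e k) := he'
    have lift : ∀ φ' : N →ₗ[R] R, ∃ φ : K →ₗ[PowerSeries R] PowerSeries R,
        ∀ k, constantCoeff (φ k) = φ' (ρ k) := by
      intro φ'
      obtain ⟨ψ, hψ⟩ := lift_F n (φ'.comp (ρ.comp π))
      replace hψ : ∀ x, constantCoeff (ψ x) = φ' (ρ (π x)) := hψ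
      obtain ⟨φ1, hφ1⟩ := divX (ψ ∘ₗ (LinearMap.ker π).subtype) (fun a => by
        have : π a.1 = 0 := a.2
        rw [LinearMap.comp_apply, Submodule.subtype_apply, hψ, this, map_zero, map_zero])
      replace hφ1 : ∀ a : LinearMap.ker π, X * φ1 a = ψ a.1 := hφ1
      obtain ⟨ψ1, hψ1⟩ := ext_ker hS hN.e1 ρ' h2 h3 h5 h6 φ1
      obtain ⟨φ, hφ⟩ := factor_surj' π h1 (ψ - (X : PowerSeries R) • ψ1) (fun w hw => by
        have a1 := hφ1 ⟨w, hw⟩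
        have a2 := hψ1 ⟨w, hw⟩
        rw [LinearMap.sub_apply, LinearMap.smul_apply, smul_eq_mul, a2, a1, sub_self])
      refine ⟨φ, fun k => ?_⟩
      obtain ⟨x, rfl⟩ := h1 k
      rw [hφ, ← hψ]
      simp
    have hext : ∀ φ' : N →ₗ[R] R, ∃ ψ' : (Fin m → R) →ₗ[R] R, ∀ a, ψ' (e' a) = φ' a := by
      intro φ'
      obtain ⟨φ, hφ⟩ := lift φ'
      have hmem : φ ∈ Submodule.span (PowerSeries R) (Set.range v) := by rw [hv]; trivial
      obtain ⟨c, hc⟩ := (Submodule.mem_span_range_iff_exists_fun _).1 hmem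
      refine ⟨∑ i, constantCoeff (c i) • LinearMap.proj i, fun a => ?_⟩
      obtain ⟨k, rfl⟩ := hρ.surj a
      rw [he', ← hφ, ← hc]
      simp [e, rhoF]
    have hNfin : Module.Finite R N := Module.Finite.of_surjective π' h2
    obtain ⟨hinj', hcok⟩ := gp_coker hN inferInstance e' (ext_proj e' hext)
    have hker : ∀ k, e k = 0 → ∃ k', k = (X : PowerSeries R) • k' := by
      intro k hk
      apply hρ.ker
      apply hinj'
      rw [he', hk, map_zero, map_zero]
    have hinj : Function.Injective e := by
      rw [← LinearMap.ker_eq_bot]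
      refine Submodule.eq_bot_of_le_smul_of_le_jacobson_bot (Ideal.span {X}) _ (coh_ker hS e)
        ?_ X_jac
      intro k hk
      obtain ⟨k', rfl⟩ := hker k hk
      refine Submodule.smul_mem_smul (Ideal.mem_span_singleton_self X) ?_
      rw [LinearMap.mem_ker, map_smul] at hk
      exact reg_F m _ hk
    let D := LinearMap.range e
    let D' := LinearMap.range e'
    refine ⟨ModuleCat.of _ (Fin m → PowerSeries R), ModuleCat.of _ ((Fin m → PowerSeries R) ⧸ D),
      e, D.mkQ, inferInstanceAs (Module.Projective (PowerSeries R) (Fin m → PowerSeries R)),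
      ⟨hinj, fun a => (Submodule.Quotient.mk_eq_zero D).2 ⟨a, rfl⟩,
        fun b hb => (Submodule.Quotient.mk_eq_zero D).1 hb, D.mkQ_surjective⟩, ?_, ?_,
      ModuleCat.of R ((Fin m → R) ⧸ D'), D.liftQ (D'.mkQ.comp (rhoF R m)) ?_, ⟨?_, ?_⟩, hcok⟩
    · refine Module.finitePresentation_of_surjective D.mkQ D.mkQ_surjective ?_
      rw [D.ker_mkQ]
      exact Module.Finite.iff_fg.1 inferInstance
    · intro y hy
      obtain ⟨w, rfl⟩ := D.mkQ_surjective y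
      rw [← map_smul] at hy
      obtain ⟨k, hk⟩ := (Submodule.Quotient.mk_eq_zero D).1 hy
      obtain ⟨k', rfl⟩ := hρ.ker k (hinj' (by rw [he', hk, bar_zero, map_zero]))
      refine (Submodule.Quotient.mk_eq_zero D).2 ⟨k', ?_⟩
      rw [← sub_eq_zero]
      apply reg_F
      rw [smul_sub, ← hk, map_smul, sub_self]
    · rintro _ ⟨k, rfl⟩
      rw [LinearMap.mem_ker, LinearMap.comp_apply, ← he']
      exact (Submodule.Quotient.mk_eq_zero D').2 ⟨_, rfl⟩
    · intro y
      obtain ⟨w, rfl⟩ := D'.mkQ_surjective y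
      obtain ⟨x, rfl⟩ := (bar_F m).surj w
      exact ⟨D.mkQ x, rfl⟩
    · intro y hy
      obtain ⟨w, rfl⟩ := D.mkQ_surjective y
      obtain ⟨a, ha⟩ := (Submodule.Quotient.mk_eq_zero D').1 hy
      obtain ⟨k, rfl⟩ := hρ.surj a
      rw [he'] at ha
      obtain ⟨z, hz⟩ := (bar_F m).ker (w - e k) (by rw [map_sub, ha, sub_self])
      refine ⟨D.mkQ z, ?_⟩
      rw [← map_smul, ← hz]
      refine (Submodule.Quotient.eq D).2 ⟨k, ?_⟩
      abel
  · rintro K ⟨hfp, hreg, N, ρ, hρ, hN⟩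
    obtain ⟨n, π, π', ρ', h1, h2, h3, h4, h5, h6⟩ := syz hS hreg ρ hρ
    refine ⟨ModuleCat.of _ (Fin n → PowerSeries R), ModuleCat.of _ (LinearMap.ker π),
      (LinearMap.ker π).subtype, π,
      inferInstanceAs (Module.Projective (PowerSeries R) (Fin n → PowerSeries R)),
      ⟨Subtype.val_injective, fun a => a.2, fun b hb => ⟨⟨b, hb⟩, rfl⟩, h1⟩, h3, ?_,
      ModuleCat.of R (LinearMap.ker π'), ρ', h5, ?_⟩
    · intro k hk
      exact Subtype.ext (reg_F n _ (congrArg Subtype.val hk))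
    · exact gp_ker (LinearMap.ker π').subtype π'
        ⟨Subtype.val_injective, fun a => a.2, fun b hb => ⟨⟨b, hb⟩, rfl⟩, h2⟩ gp_proj hN

lemma main (hS : GW.IsCoherentRing (PowerSeries R)) (n : ℕ) :
    ∀ (K : ModuleCat.{0} (PowerSeries R)) (N : ModuleCat.{0} R)
      (ρ : K →ₛₗ[constantCoeff (R := R)] N), Module.FinitePresentation (PowerSeries R) K →
      (∀ k : K, (X : PowerSeries R) • k = 0 → k = 0) → Bar ρ → dimLE R n N →
      GW.gpdLE (PowerSeries R) n K := by
  induction n with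
  | zero =>
    intro K N ρ hfp hreg hρ hN
    exact isGProj_of_good _ (good_cls hS) K ⟨hfp, hreg, N, ρ, hρ, hN⟩
  | succ n ih =>
    intro K N ρ hfp hreg hρ hN
    obtain ⟨m, π, π', ρ', h1, h2, h3, h4, h5, h6⟩ := syz hS hreg ρ hρ
    refine ⟨ModuleCat.of _ (LinearMap.ker π), ModuleCat.of _ (Fin m → PowerSeries R),
      (LinearMap.ker π).subtype, π, ?_, Subtype.val_injective, h1, ?_, ?_⟩
    · exact isGProj_of_good _ good_proj _
        (inferInstanceAs (Module.Projective (PowerSeries R) (Fin m → PowerSeries R)))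
    · intro y
      exact ⟨fun hy => ⟨⟨y, hy⟩, rfl⟩, by rintro ⟨x, rfl⟩; exact x.2⟩
    · refine ih _ (ModuleCat.of R (LinearMap.ker π')) ρ' h3 ?_ h5 ?_
      · intro k hk
        exact Subtype.ext (reg_F m _ (congrArg Subtype.val hk))
      · exact dimLE_syz n (ModuleCat.of R (LinearMap.ker π')) (ModuleCat.of R (Fin m → R)) N
          (LinearMap.ker π').subtype π'
          ⟨Subtype.val_injective, fun a => a.2, fun b hb => ⟨⟨b, hb⟩, rfl⟩, h2⟩
          (inferInstanceAs (Module.Projective R (Fin m → R))) hN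

end PS

end GWX

/-- if `R[[X]]` is coherent and `M` is a finitely presented `R[[X]]`-module on
which `X` is a nonzero divisor, then `Gpd_{R[[X]]}(M) ≤ Gpd_R(M/XM)`. -/
theorem stmt8 (R : Type) [CommRing R] (hR : GW.IsCoherentRing R)
    (hS : GW.IsCoherentRing (PowerSeries R)) (M : ModuleCat.{0} (PowerSeries R))
    (hfp : Module.FinitePresentation (PowerSeries R) M)
    (hreg : ∀ m : M, (PowerSeries.X : PowerSeries R) • m = 0 → m = 0) :
    GW.gpd (PowerSeries R) M ≤
      GW.gpd R ((ModuleCat.restrictScalars (algebraMap R (PowerSeries R))).obj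
        (ModuleCat.of (PowerSeries R) (M ⧸ GW.Xsub M))) := by
  refine le_iInf₂ (fun n hn => ?_)
  refine iInf₂_le n ?_
  let ρ : M →ₛₗ[PowerSeries.constantCoeff (R := R)]
      ((ModuleCat.restrictScalars (algebraMap R (PowerSeries R))).obj
        (ModuleCat.of (PowerSeries R) (M ⧸ GW.Xsub M))) :=
    { toFun := fun m => (GW.Xsub M).mkQ m
      map_add' := fun x y => map_add (GW.Xsub M).mkQ x y
      map_smul' := fun s x => by
        change (GW.Xsub M).mkQ (s • x) =
          (algebraMap R (PowerSeries R) (PowerSeries.constantCoeff s)) • (GW.Xsub M).mkQ x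
        rw [← map_smul]
        refine (Submodule.Quotient.eq _).2 ?_
        rw [← sub_smul]
        obtain ⟨t, ht⟩ : (PowerSeries.X : PowerSeries R) ∣
            s - algebraMap R (PowerSeries R) (PowerSeries.constantCoeff s) := by
          rw [PowerSeries.X_dvd_iff]
          simp [PowerSeries.algebraMap_apply]
        rw [ht, mul_smul]
        exact ⟨t • x, rfl⟩ }
  refine GWX.main hS n M _ ρ hfp hreg ⟨(GW.Xsub M).mkQ_surjective, ?_⟩
    (GWX.dimLE_of_gpdLE n _ hn)
  intro k hk
  obtain ⟨k', hk'⟩ := (Submodule.Quotient.mk_eq_zero (GW.Xsub M)).1 hk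
  exact ⟨k', hk'.symm⟩
end
end

section
/- Let R be a coherent commutative ring and n ≥ 0. The following are equivalent: (1) R is n-FC, i.e. FP-id_R(R) ≤ n; (2) the Gorenstein weak dimension of R is at most n; (3) every finitely presented R-module has Gorenstein projective dimension at most n. -/
open CategoryTheory

noncomputable section

namespace GWP

variable {R : Type} [CommRing R]

/-- vanishing of `Ext^k(A, B)` (derived category version). -/
def EV (R : Type) [CommRing R] (k : ℕ) (A B : Type) [AddCommGroup A] [Module R A]
    [AddCommGroup B] [Module R B] : Prop :=
  Subsingleton (Abelian.Ext.{0} (ModuleCat.of R A) (ModuleCat.of R B) k)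

lemma ev_bridge (n : ℕ) (M N : ModuleCat.{0} R) :
    Subsingleton (GW.extGrp R (n + 1) M N) ↔ EV R (n + 1) M N := by
  let P := ProjectiveResolution.of M
  have e := P.isoExt (R := R) (n + 1) N
  have h1 : Subsingleton (GW.extGrp R (n + 1) M N) ↔
      (P.complex.linearYonedaObj R N).ExactAt (n + 1) := by
    rw [HomologicalComplex.exactAt_iff_isZero_homology, ← ModuleCat.isZero_iff_subsingleton]
    exact e.isZero_iff
  rw [h1, HomologicalComplex.exactAt_iff' _ n (n + 1) (n + 2) (by simp) (by simp),
    ShortComplex.moduleCat_exact_iff]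
  constructor
  · intro h
    refine ⟨fun a b => ?_⟩
    suffices ∀ a : Abelian.Ext.{0} M N (n + 1), a = 0 from (this a).trans (this b).symm
    intro a
    obtain ⟨f, hf, rfl⟩ := P.extMk_surjective a (n + 2) rfl
    rw [P.extMk_eq_zero_iff f (n + 2) rfl hf n rfl]
    exact h f hf
  · intro h f hf
    have : P.extMk (Y := N) f (n + 2) rfl hf = 0 := by
      have : Subsingleton (Abelian.Ext.{0} M N (n + 1)) := h
      exact Subsingleton.elim _ _
    rw [P.extMk_eq_zero_iff f (n + 2) rfl hf n rfl] at this
    exact this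

section
variable {X Y Z : Type} [AddCommGroup X] [Module R X] [AddCommGroup Y] [Module R Y]
  [AddCommGroup Z] [Module R Z]
variable (B : Type) [AddCommGroup B] [Module R B]

lemma ses (f : X →ₗ[R] Y) (g : Y →ₗ[R] Z)
    (hf : Function.Injective f) (hg : Function.Surjective g) (h : Function.Exact f g) :
    ∃ w, (ShortComplex.mk (ModuleCat.ofHom f) (ModuleCat.ofHom g) w).ShortExact := by
  refine ⟨?_, ?_⟩
  · ext x; exact h.apply_apply_eq_zero x
  · have h1 := (ModuleCat.mono_iff_injective (ModuleCat.ofHom f)).2 hf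
    have h2 := (ModuleCat.epi_iff_surjective (ModuleCat.ofHom g)).2 hg
    refine @ShortComplex.ShortExact.mk _ _ _ _ ?_ h1 h2
    rw [ShortComplex.moduleCat_exact_iff]
    intro y hy
    exact (h y).1 hy

variable {B}

lemma ev_of_forall {k : ℕ} {A : Type} [AddCommGroup A] [Module R A]
    (H : ∀ a : Abelian.Ext.{0} (ModuleCat.of R A) (ModuleCat.of R B) k, a = 0) :
    EV R k A B := ⟨fun a b => (H a).trans (H b).symm⟩

lemma EV.elim {k : ℕ} {A : Type} [AddCommGroup A] [Module R A] (H : EV R k A B)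
    (a : Abelian.Ext.{0} (ModuleCat.of R A) (ModuleCat.of R B) k) : a = 0 :=
  haveI : Subsingleton (Abelian.Ext.{0} (ModuleCat.of R A) (ModuleCat.of R B) k) := H
  Subsingleton.elim _ _

lemma ev_up (f : X →ₗ[R] Y) (g : Y →ₗ[R] Z)
    (hf : Function.Injective f) (hg : Function.Surjective g) (h : Function.Exact f g)
    {k : ℕ} (hX : EV R k X B) (hY : EV R (k + 1) Y B) : EV R (k + 1) Z B := by
  obtain ⟨w, hS⟩ := ses f g hf hg h
  refine ev_of_forall fun a => ?_
  obtain ⟨x, rfl⟩ := Abelian.Ext.contravariant_sequence_exact₃ hS _ a (hY.elim _) (add_comm 1 k)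
  have : x = 0 := hX.elim x
  rw [this, Abelian.Ext.comp_zero]

lemma ev_down (f : X →ₗ[R] Y) (g : Y →ₗ[R] Z)
    (hf : Function.Injective f) (hg : Function.Surjective g) (h : Function.Exact f g)
    {k : ℕ} (hZ : EV R (k + 1) Z B) (hY : EV R k Y B) : EV R k X B := by
  obtain ⟨w, hS⟩ := ses f g hf hg h
  refine ev_of_forall fun a => ?_
  obtain ⟨x, rfl⟩ := Abelian.Ext.contravariant_sequence_exact₁ hS _ a (add_comm 1 k) (hZ.elim _)
  have : x = 0 := hY.elim x
  rw [this, Abelian.Ext.comp_zero]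

lemma ev_mid (f : X →ₗ[R] Y) (g : Y →ₗ[R] Z)
    (hf : Function.Injective f) (hg : Function.Surjective g) (h : Function.Exact f g)
    {k : ℕ} (hX : EV R k X B) (hZ : EV R k Z B) : EV R k Y B := by
  obtain ⟨w, hS⟩ := ses f g hf hg h
  refine ev_of_forall fun a => ?_
  obtain ⟨x, rfl⟩ := Abelian.Ext.contravariant_sequence_exact₂ hS _ a (hX.elim _)
  have : x = 0 := hZ.elim x
  rw [this, Abelian.Ext.comp_zero]

lemma ev_one (f : X →ₗ[R] Y) (g : Y →ₗ[R] Z)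
    (hf : Function.Injective f) (hg : Function.Surjective g) (h : Function.Exact f g)
    (hY : EV R 1 Y B) (H : ∀ φ : X →ₗ[R] B, ∃ ψ : Y →ₗ[R] B, ψ ∘ₗ f = φ) :
    EV R 1 Z B := by
  obtain ⟨w, hS⟩ := ses f g hf hg h
  refine ev_of_forall fun a => ?_
  obtain ⟨x, rfl⟩ := Abelian.Ext.contravariant_sequence_exact₃ hS _ a (hY.elim _) (add_comm 1 0)
  obtain ⟨φ, rfl⟩ := (Abelian.Ext.mk₀_bijective _ _).2 x
  obtain ⟨ψ, hψ⟩ := H φ.hom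
  have : φ = ModuleCat.ofHom f ≫ ModuleCat.ofHom ψ := by
    ext x; exact (congr($hψ x)).symm
  rw [this, ← Abelian.Ext.mk₀_comp_mk₀]
  exact hS.extClass_comp_assoc _

lemma ev_one_ext (f : X →ₗ[R] Y) (g : Y →ₗ[R] Z)
    (hf : Function.Injective f) (hg : Function.Surjective g) (h : Function.Exact f g)
    (H : EV R 1 Z B) (φ : X →ₗ[R] B) : ∃ ψ : Y →ₗ[R] B, ψ ∘ₗ f = φ := by
  obtain ⟨w, hS⟩ := ses f g hf hg h
  obtain ⟨x, hx⟩ := Abelian.Ext.contravariant_sequence_exact₁ hS _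
    (Abelian.Ext.mk₀ (ModuleCat.ofHom φ)) (add_comm 1 0) (H.elim _)
  obtain ⟨ψ, rfl⟩ := (Abelian.Ext.mk₀_bijective _ _).2 x
  rw [Abelian.Ext.mk₀_comp_mk₀] at hx
  have := (Abelian.Ext.mk₀_bijective _ _).1 hx
  refine ⟨ψ.hom, ?_⟩
  ext x
  exact congr(($this).hom x)

lemma ev_proj (P : Type) [AddCommGroup P] [Module R P] [Module.Projective R P] (k : ℕ) :
    EV R (k + 1) P B := by
  have : Projective (ModuleCat.of R P) := (IsProjective.iff_projective (R := R) P).1 inferInstance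
  exact ev_of_forall fun a => Abelian.Ext.eq_zero_of_projective a

lemma ev_inj (A : Type) [AddCommGroup A] [Module R A] (J : Type) [AddCommGroup J] [Module R J]
    [Module.Injective R J] (k : ℕ) :
    EV R (k + 1) A J := by
  have : Injective (ModuleCat.of R J) := (Module.injective_iff_injective_object (R := R) J).1 inferInstance
  exact ev_of_forall fun a => Abelian.Ext.eq_zero_of_injective a

lemma ev_zero (k : ℕ) {A : Type} [AddCommGroup A] [Module R A] [Subsingleton A] : EV R (k+1) A B := by
  exact ev_proj A k

lemma ev_congr (e : X ≃ₗ[R] Y) {k : ℕ} (hX : EV R (k + 1) X B) : EV R (k + 1) Y B :=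
  ev_mid (Z := PUnit) e.toLinearMap 0 e.injective (fun x => ⟨0, Subsingleton.elim _ _⟩)
    (fun y => ⟨fun _ => e.surjective y, fun _ => rfl⟩) hX (ev_zero k)

/-- covariant shift: here `0 → X → Y → Z → 0` in the second variable. -/
lemma ev_cov_up (f : X →ₗ[R] Y) (g : Y →ₗ[R] Z)
    (hf : Function.Injective f) (hg : Function.Surjective g) (h : Function.Exact f g)
    {A : Type} [AddCommGroup A] [Module R A] {k : ℕ} (hZ : EV R k A Z)
    (hY : EV R (k + 1) A Y) : EV R (k + 1) A X := by
  obtain ⟨w, hS⟩ := ses f g hf hg h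
  refine ev_of_forall fun a => ?_
  obtain ⟨x, rfl⟩ := Abelian.Ext.covariant_sequence_exact₁ _ hS a (hY.elim _) rfl
  have : x = 0 := hZ.elim x
  rw [this, Abelian.Ext.zero_comp]

lemma ev_cov_down (f : X →ₗ[R] Y) (g : Y →ₗ[R] Z)
    (hf : Function.Injective f) (hg : Function.Surjective g) (h : Function.Exact f g)
    {A : Type} [AddCommGroup A] [Module R A] {k : ℕ} (hX : EV R (k + 1) A X)
    (hY : EV R k A Y) : EV R k A Z := by
  obtain ⟨w, hS⟩ := ses f g hf hg h
  refine ev_of_forall fun a => ?_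
  obtain ⟨x, rfl⟩ := Abelian.Ext.covariant_sequence_exact₃ _ hS a rfl (hX.elim _)
  have : x = 0 := hY.elim x
  rw [this, Abelian.Ext.zero_comp]

end

end GWP

namespace GWP

variable {R : Type} [CommRing R]

/-- the transpose -/
def du {A B : Type} [AddCommGroup A] [Module R A] [AddCommGroup B] [Module R B]
    (u : A →ₗ[R] B) : (B →ₗ[R] R) →ₗ[R] (A →ₗ[R] R) := LinearMap.lcomp R R u

@[simp] lemma du_apply {A B : Type} [AddCommGroup A] [Module R A] [AddCommGroup B] [Module R B]
    (u : A →ₗ[R] B) (φ : B →ₗ[R] R) : du u φ = φ ∘ₗ u := rfl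

lemma du_injective {A B : Type} [AddCommGroup A] [Module R A] [AddCommGroup B] [Module R B]
    {u : A →ₗ[R] B} (hu : Function.Surjective u) : Function.Injective (du u) := by
  intro φ ψ h
  ext x
  obtain ⟨y, rfl⟩ := hu x
  exact congr($h y)

lemma exists_factor {Y Z W : Type} [AddCommGroup Y] [Module R Y] [AddCommGroup Z] [Module R Z]
    [AddCommGroup W] [Module R W] (b : Y →ₗ[R] Z) (hb : Function.Surjective b) (φ : Y →ₗ[R] W)
    (h : ∀ y, b y = 0 → φ y = 0) : ∃ ψ : Z →ₗ[R] W, ψ ∘ₗ b = φ := by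
  refine ⟨(LinearMap.ker b).liftQ φ (fun y hy => h y hy) ∘ₗ
    (b.quotKerEquivOfSurjective hb).symm.toLinearMap, ?_⟩
  ext y
  have : (b.quotKerEquivOfSurjective hb).symm (b y) = (LinearMap.ker b).mkQ y := by
    rw [LinearEquiv.symm_apply_eq]; rfl
  rw [LinearMap.comp_apply, LinearMap.comp_apply, LinearEquiv.coe_coe, this]
  rfl

lemma coh_inj_fin (hR : GW.IsCoherentRing R) (m : ℕ) : ∀ (X : Type) [AddCommGroup X] [Module R X]
    [Module.Finite R X] (ι : X →ₗ[R] (Fin m → R)), Function.Injective ι →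
    Module.FinitePresentation R X := by
  induction m with
  | zero =>
    intro X _ _ _ ι hι
    have : Subsingleton X := hι.subsingleton
    exact Module.finitePresentation_of_projective R X
  | succ m ih =>
    intro X _ _ _ ι hι
    let p : X →ₗ[R] R := LinearMap.proj 0 ∘ₗ ι
    have hI : Module.FinitePresentation R (LinearMap.range p) := hR _ (Submodule.fg_range p)
    let p' := p.rangeRestrict
    have hp' : Function.Surjective p' := p.surjective_rangeRestrict
    have hfg : Module.Finite R (LinearMap.ker p') :=
      .of_fg (Module.FinitePresentation.fg_ker p' hp')
    have := ih (LinearMap.ker p')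
      (LinearMap.pi (fun i => LinearMap.proj i.succ ∘ₗ ι ∘ₗ (LinearMap.ker p').subtype)) (by
        rw [injective_iff_map_eq_zero]
        rintro ⟨x, hx⟩ h
        have hx0 : ι x 0 = 0 := congr(($hx : R))
        apply Subtype.ext
        apply hι
        rw [Submodule.coe_zero, map_zero]
        funext i
        refine Fin.cases hx0 (fun j => ?_) i
        exact congrFun h j)
    exact Module.finitePresentation_of_ker p' hp'

lemma coh_inj (hR : GW.IsCoherentRing R) {X F : Type} [AddCommGroup X] [Module R X]
    [Module.Finite R X] [AddCommGroup F] [Module R F] [Module.Finite R F] [Module.Free R F]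
    (ι : X →ₗ[R] F) (hι : Function.Injective ι) : Module.FinitePresentation R X := by
  let b := (Module.Free.chooseBasis R F).reindex (Fintype.equivFin _)
  exact coh_inj_fin hR _ X (b.equivFun.toLinearMap ∘ₗ ι) (b.equivFun.injective.comp hι)

lemma coh_ker (hR : GW.IsCoherentRing R) {M F : Type} [AddCommGroup M] [Module R M]
    [Module.FinitePresentation R M] [AddCommGroup F] [Module R F] [Module.Finite R F]
    [Module.Free R F] (g : F →ₗ[R] M) (hg : Function.Surjective g) :
    Module.FinitePresentation R (LinearMap.ker g) := by
  have : Module.Finite R (LinearMap.ker g) := .of_fg (Module.FinitePresentation.fg_ker g hg)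
  exact coh_inj hR (LinearMap.ker g).subtype (Submodule.subtype_injective _)

lemma dual_fg (hR : GW.IsCoherentRing R) {K : Type} [AddCommGroup K] [Module R K]
    [Module.FinitePresentation R K] : Module.Finite R (K →ₗ[R] R) := by
  obtain ⟨m, b, hb⟩ := Module.Finite.exists_fin' R K
  have := coh_ker hR b hb
  obtain ⟨m', a, ha⟩ := Module.Finite.exists_fin' R (LinearMap.ker b)
  let a' := (LinearMap.ker b).subtype ∘ₗ a
  let t := a'.dualMap
  have h1 : Module.FinitePresentation R (LinearMap.range t) :=
    coh_inj hR (X := LinearMap.range t) (LinearMap.range t).subtype (Submodule.subtype_injective _)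
  have h2 : Module.Finite R (LinearMap.ker t.rangeRestrict) :=
    .of_fg (Module.FinitePresentation.fg_ker (N := LinearMap.range t) t.rangeRestrict
      t.surjective_rangeRestrict)
  rw [LinearMap.ker_rangeRestrict] at h2
  have hk : ∀ φ : (K →ₗ[R] R), (du b) φ ∈ LinearMap.ker t := by
    intro φ
    rw [LinearMap.mem_ker]
    ext x
    simp [t, a']
  have hinj : Function.Injective (du b) := du_injective hb
  have hb' : Function.Bijective ((du b).codRestrict (LinearMap.ker t) hk) := by
    constructor
    · intro x y h
      exact hinj (congrArg Subtype.val h)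
    · rintro ⟨φ, hφ⟩
      obtain ⟨ψ, hψ⟩ := exists_factor b hb φ (by
        intro y hy
        obtain ⟨x, hx⟩ := ha ⟨y, hy⟩
        have := congr($hφ x)
        simpa [t, a', hx] using this)
      exact ⟨ψ, Subtype.ext hψ⟩
  exact Module.Finite.equiv (LinearEquiv.ofBijective _ hb').symm

open TensorProduct

/-- the pairing `A ⊗ N → Hom(A*, N)`. -/
def theta (R : Type) [CommRing R] (A N : Type) [AddCommGroup A] [Module R A] [AddCommGroup N]
    [Module R N] : A ⊗[R] N →ₗ[R] ((A →ₗ[R] R) →ₗ[R] N) :=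
  dualTensorHom R (A →ₗ[R] R) N ∘ₗ (Module.Dual.eval R A).rTensor N

section
variable {A A' N : Type} [AddCommGroup A] [Module R A] [AddCommGroup A'] [Module R A']
  [AddCommGroup N] [Module R N]

lemma theta_nat (u : A →ₗ[R] A') (z : A ⊗[R] N) :
    theta R A' N (u.rTensor N z) = theta R A N z ∘ₗ (du u) := by
  induction z with
  | zero => simp
  | tmul a n => ext φ; simp [theta]
  | add x y hx hy => simp only [map_add, hx, hy, LinearMap.add_comp]

lemma theta_bij [Module.Free R A] [Module.Finite R A] : Function.Bijective (theta R A N) := by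
  have h1 : Function.Bijective (dualTensorHom R (A →ₗ[R] R) N) :=
    (dualTensorHomEquiv R (A →ₗ[R] R) N).bijective
  have h2 : Function.Bijective ((Module.Dual.eval R A).rTensor N) :=
    (LinearEquiv.rTensor N (Module.evalEquiv R A)).bijective
  exact h1.comp h2

lemma theta_inj {F0 F1 : Type} [AddCommGroup F0] [Module R F0] [AddCommGroup F1] [Module R F1]
    [Module.Free R F0] [Module.Finite R F0] [Module.Free R F1] [Module.Finite R F1]
    (a : F1 →ₗ[R] F0) (b : F0 →ₗ[R] A) (hab : Function.Exact a b) (hb : Function.Surjective b)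
    (hN : ∀ h : LinearMap.range (du a) →ₗ[R] N, ∃ H : (F1 →ₗ[R] R) →ₗ[R] N,
      H ∘ₗ (LinearMap.range (du a)).subtype = h) : Function.Injective (theta R A N) := by
  rw [injective_iff_map_eq_zero]
  intro z hz
  obtain ⟨z0, rfl⟩ := LinearMap.rTensor_surjective N hb z
  rw [theta_nat] at hz
  obtain ⟨h, hh⟩ := exists_factor (Z := LinearMap.range (du a)) (du a).rangeRestrict (du a).surjective_rangeRestrict
    (theta R F0 N z0) (by
      intro φ hφ
      have hφ' : φ ∘ₗ a = 0 := congrArg Subtype.val hφ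
      obtain ⟨ψ, rfl⟩ := exists_factor b hb φ (by
        intro y hy
        obtain ⟨x, rfl⟩ := (hab y).1 hy
        exact congr($hφ' x))
      exact congr($hz ψ))
  obtain ⟨H, hH⟩ := hN h
  obtain ⟨z1, rfl⟩ := (theta_bij (R := R) (A := F1) (N := N)).2 H
  have : a.rTensor N z1 = z0 := by
    apply (theta_bij (R := R) (A := F0) (N := N)).1
    rw [theta_nat, ← hh, ← hH]
    rfl
  rw [← this, ← LinearMap.rTensor_comp_apply]
  have : b ∘ₗ a = 0 := by ext x; exact hab.apply_apply_eq_zero x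
  rw [this, LinearMap.rTensor_zero]; rfl

lemma inj_extend [Module.Injective R N] (f : A →ₗ[R] A') (hf : Function.Injective f)
    (g : A →ₗ[R] N) : ∃ h : A' →ₗ[R] N, h ∘ₗ f = g := by
  obtain ⟨h, hh⟩ := Module.Injective.out (R := R) (Q := N) f hf g
  exact ⟨h, LinearMap.ext hh⟩

lemma theta_surj [Module.Finite R A] [Module.Injective R N] :
    Function.Surjective (theta R A N) := by
  intro h
  obtain ⟨m, b, hb⟩ := Module.Finite.exists_fin' R A
  obtain ⟨H, hH⟩ := inj_extend (du b) (du_injective hb) h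
  obtain ⟨z, rfl⟩ := (theta_bij (R := R) (A := Fin m → R) (N := N)).2 H
  exact ⟨b.rTensor N z, by rw [theta_nat, hH]⟩

lemma exists_pres (A : Type) [AddCommGroup A] [Module R A] [Module.FinitePresentation R A] :
    ∃ (m m' : ℕ) (a : (Fin m' → R) →ₗ[R] (Fin m → R)) (b : (Fin m → R) →ₗ[R] A),
      Function.Exact a b ∧ Function.Surjective b := by
  obtain ⟨m, b, hb⟩ := Module.Finite.exists_fin' R A
  have : Module.Finite R (LinearMap.ker b) := .of_fg (Module.FinitePresentation.fg_ker b hb)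
  obtain ⟨m', a, ha⟩ := Module.Finite.exists_fin' R (LinearMap.ker b)
  refine ⟨m, m', (LinearMap.ker b).subtype ∘ₗ a, b, fun y => ⟨fun hy => ?_, ?_⟩, hb⟩
  · obtain ⟨x, hx⟩ := ha ⟨y, hy⟩
    exact ⟨x, by simp [hx]⟩
  · rintro ⟨x, rfl⟩
    exact (a x).2

/-- Key lemma I -/
lemma key1 {K F : Type} [AddCommGroup K] [Module R K] [AddCommGroup F] [Module R F]
    [Module.FinitePresentation R K] [Module.Injective R N]
    (f : K →ₗ[R] F) (hf : ∀ φ : K →ₗ[R] R, ∃ ψ : F →ₗ[R] R, ψ ∘ₗ f = φ) :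
    Function.Injective (f.rTensor N) := by
  obtain ⟨m, m', a, b, hab, hb⟩ := exists_pres (R := R) K
  have hi := theta_inj (N := N) a b hab hb
    (fun h => inj_extend _ (Submodule.subtype_injective _) h)
  rw [injective_iff_map_eq_zero]
  intro z hz
  apply hi
  rw [map_zero]
  ext φ
  obtain ⟨ψ, rfl⟩ := hf φ
  have := theta_nat f z
  rw [hz, map_zero] at this
  exact congr($this.symm ψ)

/-- Key lemma II -/
lemma key2 {K F : Type} [AddCommGroup K] [Module R K] [AddCommGroup F] [Module R F]
    [Module.Finite R K] [Module.Finite R F] [Module.Free R F]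
    (f : K →ₗ[R] F) (hf : Function.Injective (f.rTensor (CharacterModule R))) :
    ∀ φ : K →ₗ[R] R, ∃ ψ : F →ₗ[R] R, ψ ∘ₗ f = φ := by
  have : Module.Injective R (CharacterModule R) :=
    Module.Flat.iff_characterModule_injective.1 inferInstance
  intro φ
  suffices (LinearMap.range (du f)).mkQ φ = 0 by
    rw [Submodule.mkQ_apply, Submodule.Quotient.mk_eq_zero] at this
    exact this
  apply CharacterModule.eq_zero_of_character_apply
  intro c
  let c' : CharacterModule (K →ₗ[R] R) := CharacterModule.dual (LinearMap.range (du f)).mkQ c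
  let L : (K →ₗ[R] R) →ₗ[R] CharacterModule R :=
    CharacterModule.curry (CharacterModule.dual (TensorProduct.rid R (K →ₗ[R] R)).toLinearMap c')
  have hL : ∀ k r, L k r = c' (r • k) := fun k r => rfl
  have hL0 : L ∘ₗ (du f) = 0 := by
    ext ψ r
    rw [LinearMap.comp_apply, hL, ← map_smul]
    change c ((LinearMap.range (du f)).mkQ (du f (r • ψ))) = 0
    have h0 : (LinearMap.range (du f)).mkQ (du f (r • ψ)) = 0 :=
      (Submodule.Quotient.mk_eq_zero _).2 (LinearMap.mem_range_self _ _)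
    rw [h0, map_zero]
  obtain ⟨z, hz⟩ := theta_surj L
  have : z = 0 := by
    apply hf
    apply (theta_bij (R := R) (A := F) (N := CharacterModule R)).1
    rw [theta_nat, hz, hL0, map_zero, map_zero]
  have h0 : L = 0 := by rw [← hz, this, map_zero]
  have := hL φ 1
  rw [h0, one_smul] at this
  exact this.symm

/-- tensor injectivity versus extension into character modules -/
lemma tensor_iff (f : A →ₗ[R] A') :
    Function.Injective (f.rTensor N) ↔
      ∀ φ : A →ₗ[R] CharacterModule N, ∃ ψ : A' →ₗ[R] CharacterModule N, ψ ∘ₗ f = φ := by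
  rw [rTensor_injective_iff_lcomp_surjective]
  rfl

end

end GWP

namespace GWP

variable {R : Type} [CommRing R]

lemma exists_chain {α : Type*} (C : α → Prop) (Rel : α → α → Prop)
    (hr : ∀ X, C X → ∃ Y, C Y ∧ Rel X Y) (hl : ∀ Y, C Y → ∃ X, C X ∧ Rel X Y) (M : α) (hM : C M) :
    ∃ X : ℤ → α, X 0 = M ∧ ∀ i, Rel (X i) (X (i + 1)) := by
  have hr' : ∀ X : {X // C X}, ∃ Y : {X // C X}, Rel X Y := fun X => by
    obtain ⟨Y, h1, h2⟩ := hr X X.2; exact ⟨⟨Y, h1⟩, h2⟩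
  have hl' : ∀ X : {X // C X}, ∃ Y : {X // C X}, Rel Y X := fun X => by
    obtain ⟨Y, h1, h2⟩ := hl X X.2; exact ⟨⟨Y, h1⟩, h2⟩
  choose r hr using hr'
  choose l hl using hl'
  let X : ℤ → {X // C X} := fun i => match i with
    | Int.ofNat n => r^[n] ⟨M, hM⟩
    | Int.negSucc n => l^[n + 1] ⟨M, hM⟩
  refine ⟨fun i => (X i).1, rfl, fun i => ?_⟩
  match i with
  | Int.ofNat n =>
    have : X (Int.ofNat n + 1) = r (X (Int.ofNat n)) := by
      change r^[n + 1] _ = r (r^[n] _)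
      rw [Function.iterate_succ_apply']
    dsimp only
    rw [this]
    exact hr _
  | Int.negSucc n =>
    have : X (Int.negSucc n) = l (X (Int.negSucc n + 1)) := by
      cases n with
      | zero => rfl
      | succ n =>
        change l^[n + 1 + 1] _ = l (l^[n + 1] _)
        rw [Function.iterate_succ_apply']
    dsimp only
    rw [this]
    exact hl _

/-- `0 → X → P → Y → 0` with `X → P` good. -/
def Rel (good : ∀ (X P : ModuleCat.{0} R), (X →ₗ[R] P) → Prop) (X Y : ModuleCat.{0} R) : Prop :=
  ∃ (P : ModuleCat.{0} R) (ι : X →ₗ[R] P) (π : P →ₗ[R] Y), good X P ι ∧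
    Function.Injective ι ∧ Function.Surjective π ∧ Function.Exact ι π

lemma exists_complex (good : ∀ (X P : ModuleCat.{0} R), (X →ₗ[R] P) → Prop)
    (C : ModuleCat.{0} R → Prop)
    (hr : ∀ X, C X → ∃ Y, C Y ∧ Rel good X Y) (hl : ∀ Y, C Y → ∃ X, C X ∧ Rel good X Y)
    (M : ModuleCat.{0} R) (hM : C M) :
    ∃ (X P : ℤ → ModuleCat.{0} R) (ι : ∀ i, X i →ₗ[R] P i) (π : ∀ i, P i →ₗ[R] X (i + 1)),
      (∀ i, good (X i) (P i) (ι i)) ∧ (∀ i, Function.Injective (ι i)) ∧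
      (∀ i, Function.Surjective (π i)) ∧ (∀ i, Function.Exact (ι i) (π i)) ∧
      (∀ i, Function.Exact (ι (i + 1) ∘ₗ π i) (ι (i + 1 + 1) ∘ₗ π (i + 1))) ∧
      Nonempty (M ≃ₗ[R] LinearMap.ker (ι (0 + 1) ∘ₗ π 0)) := by
  obtain ⟨X, rfl, hX⟩ := exists_chain C (Rel good) hr hl M hM
  choose P ι π h1 h2 h3 h4 using hX
  refine ⟨X, P, ι, π, h1, h2, h3, h4, fun i y => ?_, ?_⟩
  · constructor
    · intro hy
      have : π (i + 1) y = 0 := h2 _ (by simpa using hy)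
      obtain ⟨x, rfl⟩ := (h4 _ _).1 this
      obtain ⟨z, rfl⟩ := h3 _ x
      exact ⟨z, rfl⟩
    · rintro ⟨x, rfl⟩
      simp [(h4 (i + 1)).apply_apply_eq_zero]
  · have : LinearMap.ker (ι (0 + 1) ∘ₗ π 0) = LinearMap.range (ι 0) := by
      rw [LinearMap.ker_comp_of_ker_eq_bot _ (LinearMap.ker_eq_bot.2 (h2 _))]
      exact LinearMap.exact_iff.1 (h4 0)
    rw [this]
    exact ⟨LinearEquiv.ofInjective (ι 0) (h2 0)⟩

lemma isGProj_of (C : ModuleCat.{0} R → Prop)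
    (hr : ∀ X, C X → ∃ Y, C Y ∧ Rel (fun X P ι => Module.Projective R P ∧
      ∀ (Q : ModuleCat.{0} R), Module.Projective R Q → ∀ φ : X →ₗ[R] Q,
        ∃ ψ : P →ₗ[R] Q, ψ ∘ₗ ι = φ) X Y)
    (hl : ∀ X, C X → ∃ Y, C Y ∧ Rel (fun X P ι => Module.Projective R P ∧
      ∀ (Q : ModuleCat.{0} R), Module.Projective R Q → ∀ φ : X →ₗ[R] Q,
        ∃ ψ : P →ₗ[R] Q, ψ ∘ₗ ι = φ) Y X)
    (M : ModuleCat.{0} R) (hM : C M) : GW.IsGProj R M := by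
  obtain ⟨X, P, ι, π, h1, h2, h3, h4, h5, h6⟩ := exists_complex _ C hr hl M hM
  refine ⟨P, fun i => ι (i + 1) ∘ₗ π i, fun i => (h1 i).1, h5, ?_, h6⟩
  intro Q hQ i g
  constructor
  · intro hg
    have hg1 : ∀ x, g (ι (i + 1) x) = 0 := by
      intro x
      obtain ⟨y, rfl⟩ := h3 i x
      exact congr($hg y)
    obtain ⟨h, hh⟩ := exists_factor (π (i + 1)) (h3 _) g (by
      intro y hy
      obtain ⟨x, rfl⟩ := (h4 _ _).1 hy
      exact hg1 x)
    obtain ⟨k, hk⟩ := (h1 (i + 1 + 1)).2 Q hQ h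
    refine ⟨k, ?_⟩
    dsimp only
    rw [← LinearMap.comp_assoc, hk, hh]
  · rintro ⟨k, rfl⟩
    ext x
    have := (h5 i).apply_apply_eq_zero x
    simp only [LinearMap.comp_apply] at this
    simp [this]

lemma isGFlat_of (C : ModuleCat.{0} R → Prop)
    (hr : ∀ X, C X → ∃ Y, C Y ∧ Rel (fun _ P ι => Module.Flat R P ∧
      ∀ (Q : ModuleCat.{0} R), Module.Injective R Q → Function.Injective (ι.rTensor Q)) X Y)
    (hl : ∀ X, C X → ∃ Y, C Y ∧ Rel (fun _ P ι => Module.Flat R P ∧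
      ∀ (Q : ModuleCat.{0} R), Module.Injective R Q → Function.Injective (ι.rTensor Q)) Y X)
    (M : ModuleCat.{0} R) (hM : C M) : GW.IsGFlat R M := by
  obtain ⟨X, P, ι, π, h1, h2, h3, h4, h5, h6⟩ := exists_complex _ C hr hl M hM
  refine ⟨P, fun i => ι (i + 1) ∘ₗ π i, fun i => (h1 i).1, h5, ?_, h6⟩
  intro Q hQ i
  have e1 := lTensor_exact Q (h4 (i + 1)) (h3 (i + 1))
  have e2 : Function.Injective ((ι (i + 1 + 1)).lTensor Q) := by
    rw [LinearMap.lTensor_inj_iff_rTensor_inj]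
    exact (h1 _).2 Q hQ
  have e3 := LinearMap.lTensor_surjective Q (h3 i)
  rw [LinearMap.lTensor_comp, LinearMap.lTensor_comp]
  intro y
  constructor
  · intro hy
    have : (π (i + 1)).lTensor Q y = 0 := e2 (by simpa using hy)
    obtain ⟨x, rfl⟩ := (e1 _).1 this
    obtain ⟨z, rfl⟩ := e3 x
    exact ⟨z, rfl⟩
  · rintro ⟨x, rfl⟩
    simp only [LinearMap.comp_apply]
    rw [e1.apply_apply_eq_zero, map_zero]

/-- Vanishing of Ext of kernels in a Hom-exact complex. -/
lemma ev_ker {B : Type} [AddCommGroup B] [Module R B] (P : ℤ → ModuleCat.{0} R)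
    (d : ∀ i, P i →ₗ[R] P (i + 1))
    (hP : ∀ i k, EV R (k + 1) (P i) B) (hd : ∀ i, Function.Exact (d i) (d (i + 1)))
    (hB : ∀ i (g : P (i + 1) →ₗ[R] B), g ∘ₗ d i = 0 → ∃ h : P (i + 1 + 1) →ₗ[R] B,
      h ∘ₗ d (i + 1) = g) (k : ℕ) : ∀ i, EV R (k + 1) (LinearMap.ker (d i)) B := by
  have hsurj : ∀ i, ∃ g : P i →ₗ[R] LinearMap.ker (d (i + 1)), Function.Surjective g ∧
      (∀ x, (g x : P (i + 1)) = d i x) := fun i => by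
    refine ⟨(d i).codRestrict _ (fun x => (hd i).apply_apply_eq_zero x), ?_, fun x => rfl⟩
    rintro ⟨y, hy⟩
    obtain ⟨x, rfl⟩ := (hd i y).1 hy
    exact ⟨x, rfl⟩
  have hex : ∀ i (g : P i →ₗ[R] LinearMap.ker (d (i + 1))), (∀ x, (g x : P (i + 1)) = d i x) →
      Function.Exact (LinearMap.ker (d i)).subtype g := fun i g hg y => by
    rw [← Submodule.coe_eq_zero, hg]
    simp
  induction k with
  | zero =>
    intro i
    obtain ⟨i, rfl⟩ : ∃ j, i = j + 1 + 1 + 1 := ⟨i - 1 - 1 - 1, by ring⟩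
    obtain ⟨g, hg, hg'⟩ := hsurj (i + 1 + 1)
    refine ev_one _ g (Submodule.subtype_injective _) hg (hex _ g hg') (hP _ _) fun φ => ?_
    obtain ⟨g0, hg0, hg0'⟩ := hsurj (i + 1)
    obtain ⟨h, hh⟩ := hB i (φ ∘ₗ g0) (by
      ext x
      have : g0 (d i x) = 0 := by
        rw [← Submodule.coe_eq_zero, hg0']
        exact (hd i).apply_apply_eq_zero x
      simp [this])
    refine ⟨h, ?_⟩
    ext y
    obtain ⟨x, rfl⟩ := hg0 y
    have := congr($hh x)
    simpa [hg0'] using this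
  | succ k ih =>
    intro i
    obtain ⟨i, rfl⟩ : ∃ j, i = j + 1 := ⟨i - 1, by ring⟩
    obtain ⟨g, hg, hg'⟩ := hsurj i
    exact ev_up _ g (Submodule.subtype_injective _) hg (hex _ g hg') (ih i) (hP _ _)

end GWP

namespace GWP

variable {R : Type} [CommRing R]

lemma iInf_le_exists {p : ℕ → Prop} {n : ℕ} (h : (⨅ (m : ℕ) (_ : p m), (m : ℕ∞)) ≤ n) :
    ∃ m, m ≤ n ∧ p m := by
  by_contra! hc
  have : ((n + 1 : ℕ) : ℕ∞) ≤ ⨅ (m : ℕ) (_ : p m), (m : ℕ∞) := by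
    refine le_iInf fun m => le_iInf fun hm => ?_
    have : n < m := by
      by_contra h'
      exact hc m (by omega) hm
    exact_mod_cast this
  have h2 := this.trans h
  have : n + 1 ≤ n := by exact_mod_cast h2
  omega

lemma gproj_ev (M : ModuleCat.{0} R) (hM : GW.IsGProj R M) (k : ℕ) : EV R (k + 1) M R := by
  obtain ⟨P, d, hP, hd, hQ, ⟨e⟩⟩ := hM
  refine ev_congr e.symm (ev_ker P d (fun i k => ?_) hd (fun i g hg => ?_) k 0)
  · have := hP i
    exact ev_proj _ _
  · exact (hQ (ModuleCat.of R R) (inferInstanceAs (Module.Projective R R)) i g).1 hg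

lemma gpd_ev (m : ℕ) : ∀ (M : ModuleCat.{0} R), GW.gpdLE R m M → ∀ k, m ≤ k →
    EV R (k + 1) M R := by
  induction m with
  | zero => exact fun M hM k _ => gproj_ev M hM k
  | succ m ih =>
    rintro M ⟨K, G, f, g, hG, hf, hg, hfg, hK⟩ k hk
    obtain ⟨k, rfl⟩ : ∃ j, k = j + 1 := ⟨k - 1, by omega⟩
    exact ev_up f g hf hg hfg (ih K hK k (by omega)) (gproj_ev G hG _)

section
variable {X Y Z : Type} [AddCommGroup X] [Module R X] [AddCommGroup Y] [Module R Y]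
  [AddCommGroup Z] [Module R Z]

lemma ev_cov_one {A : Type} [AddCommGroup A] [Module R A] (f : X →ₗ[R] Y) (g : Y →ₗ[R] Z)
    (hf : Function.Injective f) (hg : Function.Surjective g) (h : Function.Exact f g)
    (hY : EV R 1 A Y) (H : ∀ φ : A →ₗ[R] Z, ∃ ψ : A →ₗ[R] Y, g ∘ₗ ψ = φ) : EV R 1 A X := by
  obtain ⟨w, hS⟩ := ses f g hf hg h
  refine ev_of_forall fun a => ?_
  obtain ⟨x, rfl⟩ := Abelian.Ext.covariant_sequence_exact₁ _ hS a (hY.elim _) (add_comm 0 1)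
  obtain ⟨φ, rfl⟩ := (Abelian.Ext.mk₀_bijective _ _).2 x
  obtain ⟨ψ, hψ⟩ := H φ.hom
  have : φ = ModuleCat.ofHom ψ ≫ ModuleCat.ofHom g := by
    ext x; exact (congr($hψ x)).symm
  rw [this, ← Abelian.Ext.mk₀_comp_mk₀, Abelian.Ext.comp_assoc _ _ _ (add_zero 0) (zero_add 1)]
  · have := hS.comp_extClass
    erw [this]
    rw [Abelian.Ext.comp_zero]
  · rfl

lemma char_ses (f : X →ₗ[R] Y) (g : Y →ₗ[R] Z)
    (hf : Function.Injective f) (hg : Function.Surjective g) (h : Function.Exact f g) :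
    Function.Injective (CharacterModule.dual g) ∧ Function.Surjective (CharacterModule.dual f) ∧
      Function.Exact (CharacterModule.dual g) (CharacterModule.dual f) := by
  refine ⟨CharacterModule.dual_injective_of_surjective g hg,
    CharacterModule.dual_surjective_of_injective f hf, fun c => ⟨fun hc => ?_, ?_⟩⟩
  · obtain ⟨ψ, hψ⟩ := exists_factor (R := ℤ) g.toAddMonoidHom.toIntLinearMap hg
      (AddMonoidHom.toIntLinearMap c) (by
        intro y hy
        obtain ⟨x, rfl⟩ := (h y).1 hy
        exact congr($hc x))
    exact ⟨ψ.toAddMonoidHom, by ext y; exact congr($hψ y)⟩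
  · rintro ⟨c, rfl⟩
    ext x
    change c (g (f x)) = 0
    rw [h.apply_apply_eq_zero, map_zero]

end

lemma flat_char (F : Type) [AddCommGroup F] [Module R F] [Module.Flat R F] :
    Module.Injective R (CharacterModule F) :=
  Module.Flat.iff_characterModule_injective.1 inferInstance

lemma ev_flat {F : Type} [AddCommGroup F] [Module R F] [Module.Flat R F] (k : ℕ) :
    ∀ (I : Type) [AddCommGroup I] [Module R I], EV R (k + 1) F (CharacterModule I) := by
  induction k with
  | zero =>
    intro I _ _
    let g : (I →₀ R) →ₗ[R] I := Finsupp.linearCombination R id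
    have hg : Function.Surjective g := Finsupp.linearCombination_id_surjective R I
    obtain ⟨h1, h2, h3⟩ := char_ses (X := LinearMap.ker g) (LinearMap.ker g).subtype g
      (Submodule.subtype_injective _) hg
      (LinearMap.exact_subtype_ker_map g)
    have := flat_char (R := R) (I →₀ R)
    refine ev_cov_one _ _ h1 h2 h3 (ev_inj _ _ _) fun φ => ?_
    have hi : Function.Injective ((LinearMap.ker g).subtype.lTensor F) :=
      Module.Flat.lTensor_preserves_injective_linearMap _ (Submodule.subtype_injective _)
    obtain ⟨c, hc⟩ := CharacterModule.dual_surjective_of_injective _ hi (CharacterModule.uncurry φ)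
    refine ⟨CharacterModule.curry c, ?_⟩
    ext x y
    exact congr($hc (x ⊗ₜ y))
  | succ k ih =>
    intro I _ _
    let g : (I →₀ R) →ₗ[R] I := Finsupp.linearCombination R id
    have hg : Function.Surjective g := Finsupp.linearCombination_id_surjective R I
    obtain ⟨h1, h2, h3⟩ := char_ses (X := LinearMap.ker g) (LinearMap.ker g).subtype g
      (Submodule.subtype_injective _) hg
      (LinearMap.exact_subtype_ker_map g)
    have := flat_char (R := R) (I →₀ R)
    exact ev_cov_up _ _ h1 h2 h3 (ih _) (ev_inj _ _ _)

lemma gflat_ev (M : ModuleCat.{0} R) (hM : GW.IsGFlat R M) (I : Type) [AddCommGroup I] [Module R I]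
    [Module.Injective R I] (k : ℕ) : EV R (k + 1) M (CharacterModule I) := by
  obtain ⟨P, d, hP, hd, hQ, ⟨e⟩⟩ := hM
  refine ev_congr e.symm (ev_ker P d (fun i k => ?_) hd (fun i g hg => ?_) k 0)
  · have := hP i
    exact ev_flat _ _
  · have hex := hQ (ModuleCat.of R I) (inferInstanceAs (Module.Injective R I)) i
    obtain ⟨g', hg'⟩ := exists_factor (Z := LinearMap.range (d (i + 1))) (d (i + 1)).rangeRestrict
      (LinearMap.surjective_rangeRestrict _) g (by
        intro y hy
        obtain ⟨x, rfl⟩ := (hd i y).1 (congrArg Subtype.val hy)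
        exact congr($hg x))
    have hi : Function.Injective ((LinearMap.range (d (i + 1))).subtype.lTensor I) := by
      rw [injective_iff_map_eq_zero]
      intro y hy
      obtain ⟨p, rfl⟩ := LinearMap.lTensor_surjective I
        (d (i + 1)).surjective_rangeRestrict y
      rw [← LinearMap.lTensor_comp_apply] at hy
      obtain ⟨q, rfl⟩ := (hex p).1 hy
      have h0 : (d (i + 1)).rangeRestrict ∘ₗ d i = 0 := by
        ext x
        exact (hd i).apply_apply_eq_zero x
      change (d (i + 1)).rangeRestrict.lTensor I ((d i).lTensor I q) = 0
      rw [← LinearMap.lTensor_comp_apply, h0, LinearMap.lTensor_zero]; rfl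
    rw [LinearMap.lTensor_inj_iff_rTensor_inj, tensor_iff] at hi
    obtain ⟨h, hh⟩ := hi g'
    refine ⟨h, ?_⟩
    rw [← hg', ← hh]
    rfl

lemma gfd_ev (I : Type) [AddCommGroup I] [Module R I] [Module.Injective R I] (m : ℕ) :
    ∀ (M : ModuleCat.{0} R), GW.gfdLE R m M → ∀ k, m ≤ k →
    EV R (k + 1) M (CharacterModule I) := by
  induction m with
  | zero => exact fun M hM k _ => gflat_ev M hM I k
  | succ m ih =>
    rintro M ⟨K, G, f, g, hG, hf, hg, hfg, hK⟩ k hk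
    obtain ⟨k, rfl⟩ : ∃ j, k = j + 1 := ⟨k - 1, by omega⟩
    exact ev_up f g hf hg hfg (ih K hK k (by omega)) (gflat_ev G hG I _)

lemma fp_cover (hR : GW.IsCoherentRing R) (P : Type) [AddCommGroup P] [Module R P]
    [Module.FinitePresentation R P] : ∃ (m : ℕ) (g : (Fin m → R) →ₗ[R] P),
      Function.Surjective g ∧ Module.FinitePresentation R (LinearMap.ker g) := by
  obtain ⟨m, g, hg⟩ := Module.Finite.exists_fin' R P
  exact ⟨m, g, hg, coh_ker hR g hg⟩

lemma ev_descend (hR : GW.IsCoherentRing R) (n : ℕ) : ∀ (P : Type) [AddCommGroup P] [Module R P]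
    [Module.FinitePresentation R P],
    EV R (n + 1) P (CharacterModule (CharacterModule R)) → EV R (n + 1) P R := by
  induction n with
  | zero =>
    intro P _ _ _ h
    obtain ⟨m, g, hg, hK⟩ := fp_cover hR P
    refine ev_one _ g (Submodule.subtype_injective _) hg (LinearMap.exact_subtype_ker_map g)
      (ev_proj _ _) ?_
    apply key2
    rw [tensor_iff]
    exact ev_one_ext _ g (Submodule.subtype_injective _) hg (LinearMap.exact_subtype_ker_map g) h
  | succ n ih =>
    intro P _ _ _ h
    obtain ⟨m, g, hg, hK⟩ := fp_cover hR P
    refine ev_up _ g (Submodule.subtype_injective _) hg (LinearMap.exact_subtype_ker_map g)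
      (ih _ ?_) (ev_proj _ _)
    exact ev_down _ g (Submodule.subtype_injective _) hg (LinearMap.exact_subtype_ker_map g) h
      (ev_proj _ _)

lemma ev_ascend (hR : GW.IsCoherentRing R) (E : Type) [AddCommGroup E] [Module R E]
    [Module.Injective R E] (n : ℕ) : ∀ (P : Type) [AddCommGroup P] [Module R P]
    [Module.FinitePresentation R P],
    EV R (n + 1) P R → EV R (n + 1) P (CharacterModule E) := by
  induction n with
  | zero =>
    intro P _ _ _ h
    obtain ⟨m, g, hg, hK⟩ := fp_cover hR P
    refine ev_one _ g (Submodule.subtype_injective _) hg (LinearMap.exact_subtype_ker_map g)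
      (ev_proj _ _) ?_
    rw [← tensor_iff]
    apply key1
    exact ev_one_ext _ g (Submodule.subtype_injective _) hg (LinearMap.exact_subtype_ker_map g) h
  | succ n ih =>
    intro P _ _ _ h
    obtain ⟨m, g, hg, hK⟩ := fp_cover hR P
    refine ev_up _ g (Submodule.subtype_injective _) hg (LinearMap.exact_subtype_ker_map g)
      (ih _ ?_) (ev_proj _ _)
    exact ev_down _ g (Submodule.subtype_injective _) hg (LinearMap.exact_subtype_ker_map g) h
      (ev_proj _ _)

end GWP

namespace GWP

variable {R : Type} [CommRing R]

/-- Finitely presented with vanishing positive Ext into `R`. -/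
def Gc (K : Type) [AddCommGroup K] [Module R K] : Prop :=
  Module.FinitePresentation R K ∧ ∀ k, EV R (k + 1) K R

lemma fp_ev (hR : GW.IsCoherentRing R) (n : ℕ)
    (H : ∀ (P : Type) [AddCommGroup P] [Module R P], Module.FinitePresentation R P →
      EV R (n + 1) P R) (k : ℕ) :
    ∀ (P : Type) [AddCommGroup P] [Module R P], Module.FinitePresentation R P →
      EV R (n + k + 1) P R := by
  induction k with
  | zero => exact H
  | succ k ih =>
    intro P _ _ _
    obtain ⟨m, g, hg, hK⟩ := fp_cover hR P
    exact ev_up (X := LinearMap.ker g) (LinearMap.ker g).subtype g (Submodule.subtype_injective _)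
      hg (LinearMap.exact_subtype_ker_map g) (ih _ hK) (ev_proj _ _)

lemma gc_ker (hR : GW.IsCoherentRing R) {K : Type} [AddCommGroup K] [Module R K]
    (hK : Gc (R := R) K) {m : ℕ} (b : (Fin m → R) →ₗ[R] K) (hb : Function.Surjective b) :
    Gc (R := R) (LinearMap.ker b) := by
  obtain ⟨h1, h2⟩ := hK
  refine ⟨coh_ker hR b hb, fun k => ?_⟩
  exact ev_down (X := LinearMap.ker b) (LinearMap.ker b).subtype b (Submodule.subtype_injective _)
      hb (LinearMap.exact_subtype_ker_map b) (h2 _) (ev_proj _ _)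

lemma quot_fp {M : Type} [AddCommGroup M] [Module R M] [Module.FinitePresentation R M]
    (N : Submodule R M) (hN : N.FG) : Module.FinitePresentation R (M ⧸ N) :=
  Module.finitePresentation_of_surjective N.mkQ N.mkQ_surjective (by rwa [Submodule.ker_mkQ])

lemma range_fg {A B : Type} [AddCommGroup A] [Module R A] [AddCommGroup B] [Module R B]
    [Module.Finite R A] (f : A →ₗ[R] B) : (LinearMap.range f).FG := by
  rw [LinearMap.range_eq_map]
  exact Submodule.FG.map _ Module.Finite.fg_top

lemma tr_ev (hR : GW.IsCoherentRing R) (n : ℕ)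
    (H : ∀ (P : Type) [AddCommGroup P] [Module R P], Module.FinitePresentation R P →
      EV R (n + 1) P R) (i : ℕ) :
    ∀ (j : ℕ), n ≤ j + i → ∀ (K : Type) [AddCommGroup K] [Module R K], Gc (R := R) K →
    ∀ (m m' : ℕ) (a : (Fin m' → R) →ₗ[R] (Fin m → R)) (b : (Fin m → R) →ₗ[R] K),
      Function.Exact a b → Function.Surjective b →
      EV R (j + 1) (((Fin m' → R) →ₗ[R] R) ⧸ LinearMap.range (du a)) R := by
  induction i with
  | zero =>
    intro j hj K _ _ hK m m' a b hab hb
    obtain ⟨j, rfl⟩ : ∃ l, j = n + l := ⟨j - n, by omega⟩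
    have : Module.FinitePresentation R ((Fin m' → R) →ₗ[R] R) :=
      Module.finitePresentation_of_projective _ _
    exact fp_ev hR n H _ _ (quot_fp _ (range_fg _))
  | succ i ih =>
    intro j hj K _ _ hK m m' a b hab hb
    have hK' := gc_ker hR hK b hb
    have := hK'.1
    let a' : (Fin m' → R) →ₗ[R] LinearMap.ker b :=
      a.codRestrict _ (fun x => hab.apply_apply_eq_zero x)
    have ha' : Function.Surjective a' := by
      rintro ⟨y, hy⟩
      obtain ⟨x, rfl⟩ := (hab y).1 hy
      exact ⟨x, rfl⟩
    have : Module.Finite R (LinearMap.ker a') := .of_fg (Module.FinitePresentation.fg_ker a' ha')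
    obtain ⟨l, c0, hc0⟩ := Module.Finite.exists_fin' R (LinearMap.ker a')
    let c : (Fin l → R) →ₗ[R] (Fin m' → R) := (LinearMap.ker a').subtype ∘ₗ c0
    have hca : Function.Exact c a' := by
      intro y
      constructor
      · intro hy
        obtain ⟨x, hx⟩ := hc0 ⟨y, hy⟩
        exact ⟨x, congrArg Subtype.val hx⟩
      · rintro ⟨x, rfl⟩
        exact (c0 x).2
    have hac : ∀ x, a (c x) = 0 := fun x => congrArg Subtype.val (hca.apply_apply_eq_zero x)
    have hle : LinearMap.range (du a) ≤ LinearMap.ker (du c) := by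
      rintro _ ⟨φ, rfl⟩
      ext x
      simp [hac]
    let f : (((Fin m' → R) →ₗ[R] R) ⧸ LinearMap.range (du a)) →ₗ[R] ((Fin l → R) →ₗ[R] R) :=
      (LinearMap.range (du a)).liftQ (du c) hle
    have hf : Function.Injective f := by
      rw [injective_iff_map_eq_zero]
      intro x hx
      obtain ⟨φ, rfl⟩ := Submodule.mkQ_surjective _ x
      have hφ : φ ∘ₗ c = 0 := hx
      obtain ⟨ψ, hψ⟩ := exists_factor (Z := LinearMap.ker b) a' ha' φ (by
        intro y hy
        obtain ⟨x, rfl⟩ := (hca y).1 hy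
        exact congr($hφ x))
      obtain ⟨χ, hχ⟩ := ev_one_ext (X := LinearMap.ker b) (LinearMap.ker b).subtype b
        (Submodule.subtype_injective _) hb (LinearMap.exact_subtype_ker_map b) (hK.2 0) ψ
      rw [Submodule.mkQ_apply, Submodule.Quotient.mk_eq_zero]
      refine ⟨χ, ?_⟩
      rw [← hψ, ← hχ]
      rfl
    refine ev_down f (LinearMap.range (du c)).mkQ hf (Submodule.mkQ_surjective _) ?_
      (ih (j + 1) (by omega) _ hK' _ _ c a' hca ha') (ev_proj _ _)
    rw [LinearMap.exact_iff, Submodule.ker_mkQ]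
    exact (Submodule.range_liftQ _ _ _).symm

lemma torsionless (hR : GW.IsCoherentRing R) (n : ℕ)
    (H : ∀ (P : Type) [AddCommGroup P] [Module R P], Module.FinitePresentation R P →
      EV R (n + 1) P R) {K : Type} [AddCommGroup K] [Module R K] (hK : Gc (R := R) K)
    (x : K) (hx : ∀ φ : K →ₗ[R] R, φ x = 0) : x = 0 := by
  have := hK.1
  obtain ⟨m, m', a, b, hab, hb⟩ := exists_pres (R := R) K
  have hi := theta_inj (N := R) a b hab hb (fun h => by
    refine ev_one_ext (X := LinearMap.range (du a)) _ (LinearMap.range (du a)).mkQ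
      (Submodule.subtype_injective _) (Submodule.mkQ_surjective _) ?_
      (tr_ev hR n H n 0 (by omega) K hK m m' a b hab hb) h
    rw [LinearMap.exact_iff, Submodule.ker_mkQ, Submodule.range_subtype])
  have : x ⊗ₜ[R] (1 : R) = 0 := hi (by
    rw [map_zero]
    ext φ
    simp [theta, hx])
  have := congrArg (TensorProduct.rid R K) this
  simpa using this

lemma proj_ext {X P Q : Type} [AddCommGroup X] [Module R X] [AddCommGroup P] [Module R P]
    [AddCommGroup Q] [Module R Q] [Module.Finite R X] [Module.Projective R Q]
    (ι : X →ₗ[R] P) (hι : ∀ φ : X →ₗ[R] R, ∃ ψ : P →ₗ[R] R, ψ ∘ₗ ι = φ) (φ : X →ₗ[R] Q) :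
    ∃ ψ : P →ₗ[R] Q, ψ ∘ₗ ι = φ := by
  classical
  obtain ⟨s, hs⟩ := Module.projective_def'.1 (inferInstance : Module.Projective R Q)
  obtain ⟨G, hG⟩ := (Module.Finite.fg_top : (⊤ : Submodule R X).FG)
  let T : Finset Q := G.biUnion fun g => (s (φ g)).support
  have hT : ∀ x, s (φ x) ∈ Finsupp.supported R R (T : Set Q) := by
    intro x
    have : (⊤ : Submodule R X) ≤ (Finsupp.supported R R (T : Set Q)).comap (s ∘ₗ φ) := by
      rw [← hG, Submodule.span_le]
      intro g hg
      change s (φ g) ∈ Finsupp.supported R R (T : Set Q)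
      rw [Finsupp.mem_supported]
      intro q hq
      exact Finset.mem_coe.2 (Finset.mem_biUnion.2 ⟨g, hg, hq⟩)
    exact this trivial
  choose e he using fun q : Q => hι (Finsupp.lapply q ∘ₗ s ∘ₗ φ)
  refine ⟨∑ q ∈ T, (e q).smulRight q, ?_⟩
  ext x
  have h1 : ∀ q, e q (ι x) = s (φ x) q := fun q => congr($(he q) x)
  have h2 : Finsupp.linearCombination R id (s (φ x)) = φ x := congr($hs (φ x))
  rw [Finsupp.linearCombination_apply, Finsupp.sum_of_support_subset _
    (Finsupp.mem_supported _ _ |>.1 (hT x)) _ (by simp)] at h2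
  rw [← h2]
  simp [h1]

lemma gc_free (m : ℕ) : Gc (R := R) (Fin m → R) :=
  ⟨Module.finitePresentation_of_projective _ _, fun _ => ev_proj _ _⟩

lemma gc_gproj (hR : GW.IsCoherentRing R) (n : ℕ)
    (H : ∀ (P : Type) [AddCommGroup P] [Module R P], Module.FinitePresentation R P →
      EV R (n + 1) P R) (K : ModuleCat.{0} R) (hK : Gc (R := R) K) : GW.IsGProj R K := by
  refine isGProj_of (fun K => Gc (R := R) K) ?_ ?_ K hK
  · intro K hK
    have := hK.1
    have := dual_fg hR (K := K)
    obtain ⟨m, s, hs⟩ := Module.Finite.exists_fin' R (K →ₗ[R] R)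
    let ι : K →ₗ[R] (Fin m → R) := LinearMap.pi fun j => s (Pi.single j 1)
    have hext : ∀ φ : K →ₗ[R] R, ∃ ψ : (Fin m → R) →ₗ[R] R, ψ ∘ₗ ι = φ := by
      intro φ
      obtain ⟨v, rfl⟩ := hs φ
      refine ⟨∑ j, v j • LinearMap.proj j, ?_⟩
      ext x
      conv_rhs => rw [pi_eq_sum_univ' v]
      simp [ι, LinearMap.sum_apply, map_sum]
    have hι : Function.Injective ι := by
      rw [injective_iff_map_eq_zero]
      intro x hx
      refine torsionless hR n H hK x fun φ => ?_
      obtain ⟨ψ, rfl⟩ := hext φ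
      simp [hx]
    have hex : Function.Exact ι (LinearMap.range ι).mkQ := by
      rw [LinearMap.exact_iff, Submodule.ker_mkQ]
    refine ⟨ModuleCat.of R ((Fin m → R) ⧸ LinearMap.range ι), ⟨?_, ?_⟩,
      ModuleCat.of R (Fin m → R), ι, (LinearMap.range ι).mkQ, ⟨?_, ?_⟩, hι,
      Submodule.mkQ_surjective _, hex⟩
    · exact quot_fp _ (range_fg _)
    · intro k
      cases k with
      | zero => exact ev_one ι _ hι (Submodule.mkQ_surjective _) hex (ev_proj _ _) hext
      | succ k => exact ev_up ι _ hι (Submodule.mkQ_surjective _) hex (hK.2 k) (ev_proj _ _)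
    · exact inferInstanceAs (Module.Projective R (Fin m → R))
    · intro Q hQ φ
      exact proj_ext ι hext φ
  · intro K hK
    have := hK.1
    obtain ⟨m, g, hg, -⟩ := fp_cover hR K
    have hK' := gc_ker hR hK g hg
    have := hK'.1
    refine ⟨ModuleCat.of R (LinearMap.ker g), hK', ModuleCat.of R (Fin m → R),
      (LinearMap.ker g).subtype, g, ⟨inferInstanceAs (Module.Projective R (Fin m → R)), ?_⟩,
      Submodule.subtype_injective _, hg, LinearMap.exact_subtype_ker_map g⟩
    intro Q hQ φ
    exact proj_ext (X := LinearMap.ker g) _ (ev_one_ext (X := LinearMap.ker g)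
      (LinearMap.ker g).subtype g
      (Submodule.subtype_injective _) hg (LinearMap.exact_subtype_ker_map g) (hK.2 0)) φ

lemma gpdLE_of (hR : GW.IsCoherentRing R) (n : ℕ)
    (H : ∀ (P : Type) [AddCommGroup P] [Module R P], Module.FinitePresentation R P →
      EV R (n + 1) P R) (m : ℕ) : ∀ (M : ModuleCat.{0} R), Module.FinitePresentation R M →
      (∀ k, EV R (m + k + 1) M R) → GW.gpdLE R m M := by
  induction m with
  | zero =>
    intro M hM h
    exact gc_gproj hR n H M ⟨hM, fun k => by simpa using h k⟩
  | succ m ih =>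
    intro M hM h
    obtain ⟨l, g, hg, hK⟩ := fp_cover hR M
    refine ⟨ModuleCat.of R (LinearMap.ker g), ModuleCat.of R (Fin l → R),
      (LinearMap.ker g).subtype, g, gc_gproj hR n H _ (gc_free l), Submodule.subtype_injective _, hg,
      LinearMap.exact_subtype_ker_map g, ih _ hK fun k => ?_⟩
    have := h k
    rw [show m + 1 + k + 1 = m + k + 1 + 1 by ring] at this
    exact ev_down (X := LinearMap.ker g) (LinearMap.ker g).subtype g (Submodule.subtype_injective _)
      hg (LinearMap.exact_subtype_ker_map g) this (ev_proj _ _)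

lemma one_three (hR : GW.IsCoherentRing R) (n : ℕ)
    (H : ∀ (P : Type) [AddCommGroup P] [Module R P], Module.FinitePresentation R P →
      EV R (n + 1) P R) (M : ModuleCat.{0} R) (hM : Module.FinitePresentation R M) :
    GW.gpd R M ≤ n :=
  iInf₂_le n (gpdLE_of hR n H n M hM fun k => fp_ev hR n H k _ hM)

end GWP

namespace GWP

variable {R : Type} [CommRing R]

/-- `Syz n K M`: `K` is an `n`-th syzygy of `M`. -/
def Syz (R : Type) [CommRing R] : ℕ → ModuleCat.{0} R → ModuleCat.{0} R → Prop
  | 0, K, M => K = M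
  | (n + 1), K, M => ∃ (L P : ModuleCat.{0} R) (f : L →ₗ[R] P) (g : P →ₗ[R] M),
      Module.Projective R P ∧ Function.Injective f ∧ Function.Surjective g ∧
      Function.Exact f g ∧ Syz R n K L

lemma free_cover (M : ModuleCat.{0} R) : ∃ (L P : ModuleCat.{0} R) (f : L →ₗ[R] P)
    (g : P →ₗ[R] M), Module.Projective R P ∧ Function.Injective f ∧ Function.Surjective g ∧
      Function.Exact f g := by
  let g : (M →₀ R) →ₗ[R] M := Finsupp.linearCombination R id
  exact ⟨ModuleCat.of R (LinearMap.ker g), ModuleCat.of R (M →₀ R), (LinearMap.ker g).subtype, g,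
    inferInstanceAs (Module.Projective R (M →₀ R)), Submodule.subtype_injective _,
    Finsupp.linearCombination_id_surjective R M, LinearMap.exact_subtype_ker_map g⟩

lemma syz_exists (n : ℕ) : ∀ M : ModuleCat.{0} R, ∃ K, Syz R n K M := by
  induction n with
  | zero => exact fun M => ⟨M, rfl⟩
  | succ n ih =>
    intro M
    obtain ⟨L, P, f, g, h1, h2, h3, h4⟩ := free_cover M
    obtain ⟨K, hK⟩ := ih L
    exact ⟨K, L, P, f, g, h1, h2, h3, h4, hK⟩

lemma syz_append {X P K : ModuleCat.{0} R} (f : X →ₗ[R] P) (g : P →ₗ[R] K)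
    (hP : Module.Projective R P) (hf : Function.Injective f) (hg : Function.Surjective g)
    (h : Function.Exact f g) (n : ℕ) : ∀ M, Syz R n K M → Syz R (n + 1) X M := by
  induction n with
  | zero =>
    rintro M rfl
    exact ⟨X, P, f, g, hP, hf, hg, h, rfl⟩
  | succ n ih =>
    rintro M ⟨L, P', f', g', h1, h2, h3, h4, h5⟩
    exact ⟨L, P', f', g', h1, h2, h3, h4, ih _ h5⟩

lemma syz_zero (n : ℕ) : Syz R n (ModuleCat.of R PUnit) (ModuleCat.of R PUnit) := by
  induction n with
  | zero => rfl
  | succ n ih =>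
    refine ⟨ModuleCat.of R PUnit, ModuleCat.of R PUnit, LinearMap.id, 0,
      inferInstanceAs (Module.Projective R PUnit), fun _ _ h => h, fun x => ⟨0, rfl⟩,
      fun x => ⟨fun _ => ⟨x, rfl⟩, fun _ => rfl⟩, ih⟩

lemma syz_proj (n : ℕ) (P : ModuleCat.{0} R) (hP : Module.Projective R P) :
    ∃ L, Syz R n P L := by
  obtain ⟨L, _, _, _, _, _, _, _, h⟩ := syz_append (K := ModuleCat.of R PUnit)
    (LinearMap.id : P →ₗ[R] P) 0 hP
    (fun _ _ h => h) (fun x => ⟨0, rfl⟩) (fun x => ⟨fun _ => ⟨x, rfl⟩, fun _ => rfl⟩) n _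
    (syz_zero n)
  exact ⟨L, h⟩

lemma syz_ev {B : Type} [AddCommGroup B] [Module R B] (n k : ℕ) (K : ModuleCat.{0} R) :
    ∀ M, Syz R n K M → EV R (n + k + 1) M B → EV R (k + 1) K B := by
  induction n with
  | zero =>
    rintro M rfl h
    simpa using h
  | succ n ih =>
    rintro M ⟨L, P, f, g, h1, h2, h3, h4, h5⟩ h
    rw [show n + 1 + k + 1 = n + k + 1 + 1 by ring] at h
    exact ih L h5 (ev_down f g h2 h3 h4 h (ev_proj _ _))

lemma syz_char {A : Type} [AddCommGroup A] [Module R A] (n k : ℕ) (K : ModuleCat.{0} R) :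
    ∀ M, Syz R n K M → (EV R (n + k + 1) A (CharacterModule M) ↔
      EV R (k + 1) A (CharacterModule K)) := by
  induction n with
  | zero =>
    rintro M rfl
    simp
  | succ n ih =>
    rintro M ⟨L, P, f, g, h1, h2, h3, h4, h5⟩
    rw [show n + 1 + k + 1 = n + k + 1 + 1 by ring, ← ih L h5]
    obtain ⟨c1, c2, c3⟩ := char_ses f g h2 h3 h4
    have := flat_char (R := R) P
    exact ⟨fun h => ev_cov_down _ _ c1 c2 c3 h (ev_inj _ _ _),
      fun h => ev_cov_up _ _ c1 c2 c3 h (ev_inj _ _ _)⟩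


lemma syz_flat
    (hR : GW.IsCoherentRing R) (n : ℕ)
    (H : ∀ (P : Type) [AddCommGroup P] [Module R P], Module.FinitePresentation R P →
      EV R (n + 1) P R)
    (E J : ModuleCat.{0} R) (hE : Module.Injective R E) (h : Syz R n J E) :
    Module.Flat R J := by
  rw [Module.Flat.iff_rTensor_injective]
  intro I hI
  rw [tensor_iff]
  have : Module.FinitePresentation R (R ⧸ I) := quot_fp I hI
  refine ev_one_ext (X := I) I.subtype I.mkQ (Submodule.subtype_injective _)
    (Submodule.mkQ_surjective _) ?_ ((syz_char n 0 J E h).1 (ev_ascend hR E n _ (H _ this)))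
  rw [LinearMap.exact_iff, Submodule.ker_mkQ, Submodule.range_subtype]

lemma ev_injchar
    (hR : GW.IsCoherentRing R) (n : ℕ)
    (H : ∀ (P : Type) [AddCommGroup P] [Module R P], Module.FinitePresentation R P →
      EV R (n + 1) P R)
    (E : ModuleCat.{0} R) (hE : Module.Injective R E) (A : Type) [AddCommGroup A]
    [Module R A] (k : ℕ) : EV R (n + k + 1) A (CharacterModule E) := by
  obtain ⟨J, hJ⟩ := syz_exists n E
  rw [syz_char n k J E hJ]
  have := syz_flat hR n H E J hE hJ
  have := flat_char (R := R) J
  exact ev_inj _ _ _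

lemma horseshoe (n : ℕ) (K : ModuleCat.{0} R) : ∀ (M E C : ModuleCat.{0} R) (i : M →ₗ[R] E)
    (p : E →ₗ[R] C), Function.Injective i → Function.Surjective p → Function.Exact i p →
    Syz R n K M → ∃ (F K' : ModuleCat.{0} R) (u : K →ₗ[R] F) (v : F →ₗ[R] K'),
      Syz R n F E ∧ Syz R n K' C ∧ Function.Injective u ∧ Function.Surjective v ∧
      Function.Exact u v := by
  induction n with
  | zero =>
    rintro M E C i p hi hp hip rfl
    exact ⟨E, C, i, p, rfl, rfl, hi, hp, hip⟩
  | succ n ih =>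
    rintro M E C i p hi hp hip ⟨L, P, f, g, hP, hf, hg, hfg, hS⟩
    obtain ⟨L'', P'', f'', g'', hP'', hf'', hg'', hfg''⟩ := free_cover C
    obtain ⟨h, hh⟩ := Module.projective_lifting_property p g'' hp
    have hh' : ∀ y, p (h y) = g'' y := fun y => congr($hh y)
    let G : (P × P'') →ₗ[R] E := (i ∘ₗ g).coprod h
    have hG0 : ∀ z, G z = i (g z.1) + h z.2 := fun z => rfl
    have hpi : ∀ x, p (i x) = 0 := fun x => hip.apply_apply_eq_zero x
    have hG : Function.Surjective G := by
      intro e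
      obtain ⟨y, hy⟩ := hg'' (p e)
      obtain ⟨m, hm⟩ := (hip (e - h y)).1 (by rw [map_sub, hh', hy, sub_self])
      obtain ⟨x, rfl⟩ := hg m
      exact ⟨(x, y), by rw [hG0, hm]; simp⟩
    let u : L →ₗ[R] LinearMap.ker G := (LinearMap.inl R P P'' ∘ₗ f).codRestrict _ (by
      intro x
      rw [LinearMap.mem_ker, hG0]
      simp [hfg.apply_apply_eq_zero])
    let v : LinearMap.ker G →ₗ[R] LinearMap.ker g'' :=
      (LinearMap.snd R P P'' ∘ₗ (LinearMap.ker G).subtype).codRestrict _ (by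
        rintro ⟨⟨x, y⟩, hz⟩
        rw [LinearMap.mem_ker, hG0] at hz
        have := congrArg p hz
        simpa [hpi, hh'] using this)
    obtain ⟨F, K', u', v', h1, h2, h3⟩ := ih L (ModuleCat.of R (LinearMap.ker G))
      (ModuleCat.of R (LinearMap.ker g'')) u v (by
        intro x y hxy
        have := congrArg Subtype.val hxy
        have := congrArg Prod.fst this
        exact hf this) (by
        rintro ⟨y, hy⟩
        obtain ⟨m, hm⟩ := (hip (h y)).1 (by rw [hh']; exact hy)
        obtain ⟨x, rfl⟩ := hg m
        exact ⟨⟨(-x, y), by rw [LinearMap.mem_ker, hG0]; simp [hm]⟩, rfl⟩) (by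
        rintro ⟨⟨x, y⟩, hz⟩
        constructor
        · intro hy
          have hy : y = 0 := congrArg Subtype.val hy
          subst hy
          rw [LinearMap.mem_ker, hG0] at hz
          simp only [map_zero, add_zero] at hz
          obtain ⟨l, rfl⟩ := (hfg x).1 (hi (by rw [hz, map_zero]))
          exact ⟨l, rfl⟩
        · rintro ⟨l, hl⟩
          have := congrArg Prod.snd (congrArg Subtype.val hl)
          exact Subtype.ext this.symm) hS
    refine ⟨F, K', u', v', ⟨_, ModuleCat.of R (P × P''), (LinearMap.ker G).subtype, G,
      inferInstanceAs (Module.Projective R (P × P'')), Submodule.subtype_injective _, hG,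
      LinearMap.exact_subtype_ker_map G, h1⟩, ⟨_, P'', (LinearMap.ker g'').subtype, g'', hP'',
      Submodule.subtype_injective _, hg'', LinearMap.exact_subtype_ker_map g'', h2⟩, h3⟩

lemma embed_inj (M : ModuleCat.{0} R) : ∃ (E : ModuleCat.{0} R) (i : M →ₗ[R] E),
    Module.Injective R E ∧ Function.Injective i := by
  refine ⟨Injective.under M, (Injective.ι M).hom, ?_, ?_⟩
  · exact (Module.injective_iff_injective_object R _).2
      (inferInstanceAs (Injective (Injective.under M)))
  · exact (ModuleCat.mono_iff_injective _).1 inferInstance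

lemma one_two (hR : GW.IsCoherentRing R) (n : ℕ)
    (H : ∀ (P : Type) [AddCommGroup P] [Module R P], Module.FinitePresentation R P →
      EV R (n + 1) P R) : GW.gwdim R ≤ n := by
  have hext : ∀ {X Y Z : ModuleCat.{0} R} (f : X →ₗ[R] Y) (g : Y →ₗ[R] Z),
      Function.Injective f → Function.Surjective g → Function.Exact f g →
      (∃ M, Syz R n Z M) → ∀ (Q : ModuleCat.{0} R), Module.Injective R Q →
      Function.Injective (f.rTensor Q) := by
    rintro X Y Z f g hf hg hfg ⟨M, hM⟩ Q hQ
    rw [tensor_iff]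
    exact ev_one_ext f g hf hg hfg (syz_ev n 0 Z M hM (ev_injchar hR n H Q hQ M 0))
  have key : ∀ K : ModuleCat.{0} R, (∃ M, Syz R n K M) → GW.IsGFlat R K := by
    intro K hK
    refine isGFlat_of (fun K => ∃ M, Syz R n K M) ?_ ?_ K hK
    · rintro K ⟨M, hM⟩
      obtain ⟨E, i, hE, hi⟩ := embed_inj M
      obtain ⟨F, K', u, v, h1, h2, h3, h4, h5⟩ := horseshoe n K M E
        (ModuleCat.of R (E ⧸ LinearMap.range i)) i (LinearMap.range i).mkQ hi
        (Submodule.mkQ_surjective _) (by rw [LinearMap.exact_iff, Submodule.ker_mkQ]) hM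
      exact ⟨K', ⟨_, h2⟩, F, u, v, ⟨syz_flat hR n H E F hE h1, hext u v h3 h4 h5 ⟨_, h2⟩⟩,
        h3, h4, h5⟩
    · rintro K ⟨M, hM⟩
      obtain ⟨L, P, f, g, h1, h2, h3, h4⟩ := free_cover K
      obtain ⟨M', _, _, _, _, _, _, _, h⟩ := syz_append f g h1 h2 h3 h4 n M hM
      exact ⟨L, ⟨M', h⟩, P, f, g, ⟨inferInstance, hext f g h2 h3 h4 ⟨M, hM⟩⟩, h2, h3, h4⟩
  have hdim : ∀ (m : ℕ) (K M : ModuleCat.{0} R), GW.IsGFlat R K → Syz R m K M →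
      GW.gfdLE R m M := by
    intro m K
    induction m with
    | zero =>
      rintro M hK rfl
      exact hK
    | succ m ih =>
      rintro M hK ⟨L, P, f, g, h1, h2, h3, h4, h5⟩
      exact ⟨L, P, f, g, key P (syz_proj n P h1), h2, h3, h4, ih L hK h5⟩
  refine iSup_le fun M => ?_
  obtain ⟨K, hK⟩ := syz_exists n M
  exact iInf₂_le n (hdim n K M (key K ⟨M, hK⟩) hK)

lemma two_one (hR : GW.IsCoherentRing R) (n : ℕ) (h : GW.gwdim R ≤ n) (P : Type)
    [AddCommGroup P] [Module R P] (hP : Module.FinitePresentation R P) : EV R (n + 1) P R := by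
  have h1 : GW.gfd R (ModuleCat.of R P) ≤ n := (le_iSup (GW.gfd R) _).trans h
  obtain ⟨m, hm, h2⟩ := iInf_le_exists h1
  have := flat_char (R := R) R
  exact ev_descend hR n P (gfd_ev (CharacterModule R) m _ h2 n hm)

end GWP

/-- for a coherent ring `R` and `n ≥ 0`, TFAE: `R` is `n`-FC;
`Gwdim(R) ≤ n`; every finitely presented module has `Gpd ≤ n`. -/
theorem stmt9 (R : Type) [CommRing R] (hR : GW.IsCoherentRing R) (n : ℕ) :
    List.TFAE
      [∀ P : ModuleCat.{0} R, Module.FinitePresentation R P →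
          Subsingleton ↥(GW.extGrp R (n + 1) P (ModuleCat.of R R)),
        GW.gwdim R ≤ n,
        ∀ M : ModuleCat.{0} R, Module.FinitePresentation R M → GW.gpd R M ≤ n] := by
  have e : (∀ P : ModuleCat.{0} R, Module.FinitePresentation R P →
      Subsingleton ↥(GW.extGrp R (n + 1) P (ModuleCat.of R R))) ↔
      ∀ (P : Type) [AddCommGroup P] [Module R P], Module.FinitePresentation R P →
        GWP.EV R (n + 1) P R := by
    constructor
    · intro h P _ _ hP
      exact (GWP.ev_bridge n (ModuleCat.of R P) (ModuleCat.of R R)).1 (h (ModuleCat.of R P) hP)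
    · intro h P hP
      exact (GWP.ev_bridge n P (ModuleCat.of R R)).2 (h P hP)
  rw [e]
  tfae_have 1 → 3 := fun H M hM => GWP.one_three hR n H M hM
  tfae_have 1 → 2 := fun H => GWP.one_two hR n H
  tfae_have 2 → 1 := fun h P _ _ hP => GWP.two_one hR n h P hP
  tfae_have 3 → 1 := fun h P _ _ hP => by
    obtain ⟨m, hm, h2⟩ := GWP.iInf_le_exists (h (ModuleCat.of R P) hP)
    exact GWP.gpd_ev m _ h2 n hm
  tfae_finish
end
end
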